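/- arXiv:2603.22010 — 3 statements merged into one kernel-verified Lean document; each statement's English description precedes it below -/
import Mathlib

section
/- For any finite set X of even size contained in the unit cube [0,1]^k, there exists a perfect matching M on X such that the sum over edges e of M of |e|^k is at most 2(k+1) * k^{k/2}. -/
/-- `M` is a perfect matching on the finite set `X`: every edge of `M` joins two distinct
points of `X`, and every point of `X` belongs to exactly one edge of `M`. -/
def IsPerfectMatching {k : ℕ} (X : Finset (EuclideanSpace ℝ (Fin k)))
    (M : Finset (EuclideanSpace ℝ (Fin k) × EuclideanSpace ℝ (Fin k))) : Prop :=
  (∀ e ∈ M, e.1 ∈ X ∧ e.2 ∈ X ∧ e.1 ≠ e.2) ∧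
  ∀ x ∈ X, ∃! e, e ∈ M ∧ (x = e.1 ∨ x = e.2)

open MeasureTheory

/-- Among all ways of arranging the points into ordered pairs, one minimizes the sum of squares,
and there no exchange between two pairs is profitable. -/
theorem exists_pairing {E : Type*} [SeminormedAddCommGroup E] {n : ℕ} {X : Type*} (f : X → E)
    [Finite X] (hX : Nonempty (Fin n × Bool ≃ X)) :
    ∃ σ : Fin n × Bool ≃ X, ∀ i j, i ≠ j →
      ‖f (σ (i, false)) - f (σ (i, true))‖ ^ 2 + ‖f (σ (j, false)) - f (σ (j, true))‖ ^ 2 ≤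
        ‖f (σ (i, false)) - f (σ (j, false))‖ ^ 2 + ‖f (σ (i, true)) - f (σ (j, true))‖ ^ 2 ∧
      ‖f (σ (i, false)) - f (σ (i, true))‖ ^ 2 + ‖f (σ (j, false)) - f (σ (j, true))‖ ^ 2 ≤
        ‖f (σ (i, false)) - f (σ (j, true))‖ ^ 2 + ‖f (σ (i, true)) - f (σ (j, false))‖ ^ 2 := by
  obtain ⟨σ, hσ⟩ := Finite.exists_min fun σ : Fin n × Bool ≃ X =>
    ∑ i, ‖f (σ (i, false)) - f (σ (i, true))‖ ^ 2
  refine ⟨σ, fun i j hij => ?_⟩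
  have key : ∀ b, ‖f (σ (i, false)) - f (σ (i, true))‖ ^ 2 +
        ‖f (σ (j, false)) - f (σ (j, true))‖ ^ 2 ≤
      ‖f (σ (i, false)) - f (σ (j, b))‖ ^ 2 + ‖f (σ (i, true)) - f (σ (j, !b))‖ ^ 2 := by
    intro b
    have h := hσ ((Equiv.swap (i, true) (j, b)).trans σ)
    rw [← Finset.add_sum_erase _ _ (Finset.mem_univ i),
      ← Finset.add_sum_erase _ _ (Finset.mem_erase.2 ⟨hij.symm, Finset.mem_univ j⟩),
      ← Finset.add_sum_erase _ _ (Finset.mem_univ i),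
      ← Finset.add_sum_erase _ _ (Finset.mem_erase.2 ⟨hij.symm, Finset.mem_univ j⟩)] at h
    have hrest : ∑ l ∈ (Finset.univ.erase i).erase j,
        ‖f (((Equiv.swap (i, true) (j, b)).trans σ) (l, false)) -
          f (((Equiv.swap (i, true) (j, b)).trans σ) (l, true))‖ ^ 2 =
        ∑ l ∈ (Finset.univ.erase i).erase j, ‖f (σ (l, false)) - f (σ (l, true))‖ ^ 2 := by
      refine Finset.sum_congr rfl fun l hl => ?_
      simp only [Finset.mem_erase] at hl
      simp [Equiv.swap_apply_of_ne_of_ne, hl.1, hl.2.1]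
    rw [hrest] at h
    cases b <;> simp [Equiv.swap_apply_of_ne_of_ne, hij, hij.symm] at h ⊢ <;>
      [skip; rw [norm_sub_rev (f (σ (i, true)))]] <;> linarith
  exact ⟨by simpa using key false, by simpa using key true⟩

section MinimalPairing

variable {E : Type*} [NormedAddCommGroup E] [InnerProductSpace ℝ E]

theorem inner_add_le_of_norm_sub_sq_le (a b c d : E)
    (h1 : ‖a - b‖ ^ 2 + ‖c - d‖ ^ 2 ≤ ‖a - c‖ ^ 2 + ‖b - d‖ ^ 2)
    (h2 : ‖a - b‖ ^ 2 + ‖c - d‖ ^ 2 ≤ ‖a - d‖ ^ 2 + ‖b - c‖ ^ 2) :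
    inner ℝ (a + b) (c + d) ≤ 2 * inner ℝ a b + 2 * inner ℝ c d := by
  simp only [norm_sub_sq_real, inner_add_left, inner_add_right] at *
  linarith

theorem sum_posPart_le_one {ι : Type*} (s : Finset ι) (v : ι → E) (c p : ι → ℝ)
    (hc : ∀ i ∈ s, 0 < c i) (hself : ∀ i ∈ s, inner ℝ (v i) (v i) = p i + c i)
    (hne : ∀ i ∈ s, ∀ j ∈ s, i ≠ j → inner ℝ (v i) (v j) ≤ (p i + p j) / 2) :
    ∑ i ∈ s, max 0 (-p i / c i) ≤ 1 := by
  classical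
  set t := s.filter fun i => p i < 0 with ht
  have hts : ∀ i ∈ t, i ∈ s := fun i hi => (Finset.mem_filter.1 hi).1
  have hsum : ∑ i ∈ s, max 0 (-p i / c i) = ∑ i ∈ t, -p i / c i := by
    rw [ht, Finset.sum_filter]
    refine Finset.sum_congr rfl fun i hi => ?_
    split_ifs with h
    · exact max_eq_right (div_nonneg (by linarith) (hc i hi).le)
    · exact max_eq_left (div_nonpos_of_nonpos_of_nonneg (by linarith) (hc i hi).le)
  rw [hsum]
  rcases t.eq_empty_or_nonempty with h0 | h0
  · simp [h0]
  have hW : 0 < ∑ i ∈ t, (c i)⁻¹ := Finset.sum_pos (fun i hi => inv_pos.2 (hc i (hts i hi))) h0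
  have key : 0 ≤ inner ℝ (∑ i ∈ t, (c i)⁻¹ • v i) (∑ i ∈ t, (c i)⁻¹ • v i) :=
    real_inner_self_nonneg
  rw [sum_inner] at key
  simp only [inner_sum, real_inner_smul_left, real_inner_smul_right] at key
  have hle : ∑ i ∈ t, ∑ j ∈ t, (c j)⁻¹ * ((c i)⁻¹ * inner ℝ (v i) (v j)) ≤
      ∑ i ∈ t, ∑ j ∈ t, ((c i)⁻¹ * (c j)⁻¹ * ((p i + p j) / 2) +
        if i = j then (c i)⁻¹ else 0) := by
    refine Finset.sum_le_sum fun i hi => Finset.sum_le_sum fun j hj => ?_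
    have hi' := hc i (hts i hi)
    have hj' := hc j (hts j hj)
    split_ifs with hij
    · subst hij
      rw [hself i (hts i hi)]
      apply le_of_eq
      field_simp
      ring
    · have := mul_le_mul_of_nonneg_left (hne i (hts i hi) j (hts j hj) hij)
        (show 0 ≤ (c i)⁻¹ * (c j)⁻¹ by positivity)
      linarith
  have hid : ∑ i ∈ t, ∑ j ∈ t, ((c i)⁻¹ * (c j)⁻¹ * ((p i + p j) / 2) +
        if i = j then (c i)⁻¹ else 0) =
      (∑ i ∈ t, (c i)⁻¹) * (1 - ∑ i ∈ t, -p i / c i) := by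
    simp only [Finset.sum_add_distrib, Finset.sum_ite_eq]
    rw [Finset.sum_congr rfl (fun i hi => if_pos hi)]
    have h1 : ∀ i ∈ t, ∑ j ∈ t, (c i)⁻¹ * (c j)⁻¹ * ((p i + p j) / 2) =
        ((c i)⁻¹ * p i / 2) * (∑ j ∈ t, (c j)⁻¹) + (c i)⁻¹ * (∑ j ∈ t, (c j)⁻¹ * p j / 2) := by
      intro i _
      rw [Finset.mul_sum, Finset.mul_sum, ← Finset.sum_add_distrib]
      exact Finset.sum_congr rfl fun j _ => by ring
    rw [Finset.sum_congr rfl h1, Finset.sum_add_distrib, ← Finset.sum_mul, ← Finset.sum_mul]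
    have h2 : ∑ i ∈ t, -p i / c i = - (2 * ∑ j ∈ t, (c j)⁻¹ * p j / 2) := by
      rw [Finset.mul_sum, ← Finset.sum_neg_distrib]
      exact Finset.sum_congr rfl fun j _ => by ring
    rw [h2]
    ring
  have := nonneg_of_mul_nonneg_right ((key.trans hle).trans_eq hid) hW
  linarith

end MinimalPairing

/-- The box `∏ [lo i, hi i]` contains a measurable region of volume at least `V` on which the
mean of `∑ y i ^ 2` is at most `e`. -/
def HasRegion {ι : Type} [Fintype ι] (lo hi : ι → ℝ) (V e : ℝ) : Prop :=
  ∃ Q : Set (ι → ℝ), MeasurableSet Q ∧ Q ⊆ Set.Icc lo hi ∧ V ≤ volume.real Q ∧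
    ∫ y in Q, ∑ i, y i ^ 2 ≤ e * volume.real Q

section HasRegion

variable {ι : Type} [Fintype ι] {lo hi : ι → ℝ}

theorem HasRegion.mono {V V' e e' : ℝ} (h : HasRegion lo hi V e) (hV : V' ≤ V) (he : e ≤ e') :
    HasRegion lo hi V' e' := by
  obtain ⟨Q, h1, h2, h3, h4⟩ := h
  exact ⟨Q, h1, h2, hV.trans h3, h4.trans (by gcongr)⟩

theorem integrableOn_of_subset_Icc {f : (ι → ℝ) → ℝ} (hf : Continuous f) {Q : Set (ι → ℝ)}
    (hQ : Q ⊆ Set.Icc lo hi) : IntegrableOn f Q :=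
  (hf.continuousOn.integrableOn_compact isCompact_Icc).mono_set hQ

theorem HasRegion.of_isEmpty [IsEmpty ι] : HasRegion lo hi 1 0 := by
  refine ⟨Set.univ, MeasurableSet.univ, fun x _ => ⟨fun i => isEmptyElim i, fun i => isEmptyElim i⟩,
    ?_, by simp⟩
  simp [measureReal_def, volume_pi]

theorem HasRegion.split (p : ι → Prop) [DecidablePred p] {V₁ V₂ e₁ e₂ : ℝ}
    (hV₂ : 0 ≤ V₂)
    (h₁ : HasRegion (fun i : {i // p i} => lo i) (fun i => hi i) V₁ e₁)
    (h₂ : HasRegion (fun i : {i // ¬ p i} => lo i) (fun i => hi i) V₂ e₂) :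
    HasRegion lo hi (V₁ * V₂) (e₁ + e₂) := by
  obtain ⟨Q₁, hm₁, hs₁, hv₁, he₁⟩ := h₁
  obtain ⟨Q₂, hm₂, hs₂, hv₂, he₂⟩ := h₂
  have hmp := volume_preserving_piEquivPiSubtypeProd (fun _ : ι => ℝ) p
  have hvol : volume.real ((MeasurableEquiv.piEquivPiSubtypeProd (fun _ : ι => ℝ) p) ⁻¹'
      (Q₁ ×ˢ Q₂)) = volume.real Q₁ * volume.real Q₂ := by
    rw [measureReal_def, hmp.measure_preimage (hm₁.prod hm₂).nullMeasurableSet,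
      ← measureReal_def, Measure.volume_eq_prod, measureReal_prod_prod]
  refine ⟨(MeasurableEquiv.piEquivPiSubtypeProd (fun _ : ι => ℝ) p) ⁻¹' (Q₁ ×ˢ Q₂),
    hmp.measurable (hm₁.prod hm₂), ?_, ?_, ?_⟩
  · rintro y ⟨hy₁, hy₂⟩
    have h₁ := hs₁ hy₁
    have h₂ := hs₂ hy₂
    constructor <;> intro i <;> by_cases hi : p i
    · exact h₁.1 ⟨i, hi⟩
    · exact h₂.1 ⟨i, hi⟩
    · exact h₁.2 ⟨i, hi⟩
    · exact h₂.2 ⟨i, hi⟩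
  · rw [hvol]
    gcongr
  · rw [hvol]
    have hint : ∫ y in (MeasurableEquiv.piEquivPiSubtypeProd (fun _ : ι => ℝ) p) ⁻¹' (Q₁ ×ˢ Q₂),
        ∑ i, y i ^ 2 = ∫ z in Q₁ ×ˢ Q₂, ((∑ i, z.1 i ^ 2) * 1 + 1 * ∑ i, z.2 i ^ 2) := by
      rw [← hmp.setIntegral_preimage_emb (MeasurableEquiv.measurableEmbedding _)]
      refine integral_congr_ae (Filter.Eventually.of_forall fun y => ?_)
      simp only [mul_one, one_mul]
      exact (Fintype.sum_subtype_add_sum_subtype p fun i => y i ^ 2).symm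
    have hi₁ : IntegrableOn (fun y : {i // p i} → ℝ => ∑ i, y i ^ 2) Q₁ :=
      integrableOn_of_subset_Icc (by fun_prop) hs₁
    have hi₂ : IntegrableOn (fun y : {i // ¬ p i} → ℝ => ∑ i, y i ^ 2) Q₂ :=
      integrableOn_of_subset_Icc (by fun_prop) hs₂
    have hc₁ : IntegrableOn (fun _ : {i // p i} → ℝ => (1 : ℝ)) Q₁ :=
      integrableOn_of_subset_Icc continuous_const hs₁
    have hc₂ : IntegrableOn (fun _ : {i // ¬ p i} → ℝ => (1 : ℝ)) Q₂ :=
      integrableOn_of_subset_Icc continuous_const hs₂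
    rw [hint, integral_add, Measure.volume_eq_prod,
      setIntegral_prod_mul (fun y : {i // p i} → ℝ => ∑ i, y i ^ 2) (fun _ => (1 : ℝ)),
      setIntegral_prod_mul (fun _ => (1 : ℝ)) (fun y : {i // ¬ p i} → ℝ => ∑ i, y i ^ 2)]
    · simp only [setIntegral_const, smul_eq_mul, mul_one]
      have := mul_le_mul_of_nonneg_right he₁ (measureReal_nonneg (μ := volume) (s := Q₂))
      have := mul_le_mul_of_nonneg_left he₂ (measureReal_nonneg (μ := volume) (s := Q₁))
      linarith
    · rw [Measure.volume_eq_prod, ← Measure.prod_restrict]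
      exact Integrable.mul_prod hi₁ hc₂
    · rw [Measure.volume_eq_prod, ← Measure.prod_restrict]
      exact Integrable.mul_prod hc₁ hi₂

theorem HasRegion.pi_Icc (s t e : ι → ℝ) (hst : ∀ i, s i ≤ t i) (hlo : ∀ i, lo i ≤ s i)
    (hhi : ∀ i, t i ≤ hi i)
    (he : ∀ i, (t i ^ 3 - s i ^ 3) / 3 ≤ e i * (t i - s i)) :
    HasRegion lo hi (∏ i, (t i - s i)) (∑ i, e i) := by
  classical
  have hvol : volume.real (Set.Icc s t) = ∏ i, (t i - s i) := by
    rw [measureReal_def, Real.volume_Icc_pi_toReal hst]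
  have hsub : Set.Icc s t ⊆ Set.Icc lo hi := Set.Icc_subset_Icc hlo hhi
  refine ⟨Set.Icc s t, measurableSet_Icc, hsub, hvol.ge, ?_⟩
  rw [integral_finsetSum _ fun i _ => integrableOn_of_subset_Icc (by fun_prop) hsub, hvol,
    Finset.sum_mul]
  refine Finset.sum_le_sum fun i _ => ?_
  have hprod : ∫ y in Set.Icc s t, y i ^ 2 =
      ∏ j, ∫ u in Set.Icc (s j) (t j), if j = i then u ^ 2 else 1 := by
    rw [← Set.pi_univ_Icc, volume_pi, Measure.restrict_pi_pi, ← integral_fintype_prod_eq_prod]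
    simp
  have hone : ∀ j, j ≠ i → ∫ u in Set.Icc (s j) (t j), (if j = i then u ^ 2 else 1) = t j - s j := by
    intro j hj
    simp [hj, hst j]
  have hsq : ∫ u in Set.Icc (s i) (t i), (if i = i then u ^ 2 else 1) = (t i ^ 3 - s i ^ 3) / 3 := by
    simp only [if_true]
    rw [integral_Icc_eq_integral_Ioc, ← intervalIntegral.integral_of_le (hst i), integral_pow]
    norm_num
  rw [hprod, ← Finset.mul_prod_erase _ _ (Finset.mem_univ i),
    ← Finset.mul_prod_erase _ (fun j => t j - s j) (Finset.mem_univ i), hsq,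
    Finset.prod_congr rfl fun j hj => hone j (Finset.ne_of_mem_erase hj), ← mul_assoc]
  exact mul_le_mul_of_nonneg_right (he i) (Finset.prod_nonneg fun j _ => sub_nonneg.2 (hst j))

end HasRegion

theorem map_pi_eq_smul_pi {ι : Type*} [Fintype ι] {T : ι → ℝ → ℝ} {ν : ι → Measure ℝ}
    [∀ i, SigmaFinite (ν i)] {c : NNReal} (hT : ∀ i, Measurable (T i))
    (h : ∀ i, Measure.map (T i) volume = c • ν i) :
    Measure.map (fun (y : ι → ℝ) i => T i (y i)) volume = c ^ Fintype.card ι • Measure.pi ν := by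
  have hs : ∀ i, SigmaFinite (Measure.map (T i) volume) := fun i => h i ▸ inferInstance
  rw [volume_pi, Measure.pi_map_pi fun i => (hT i).aemeasurable]
  refine Measure.pi_eq fun s _ => ?_
  simp_rw [h, Measure.smul_apply, Measure.pi_pi]
  simp [ENNReal.smul_def, Finset.prod_mul_distrib]

theorem map_abs_volume :
    Measure.map (fun x : ℝ => |x|) volume = (2 : NNReal) • volume.restrict (Set.Ici 0) := by
  have hm : Measurable fun x : ℝ => |x| := by fun_prop
  ext s hs
  have hpos : volume ((fun x : ℝ => |x|) ⁻¹' s ∩ Set.Ici 0) = volume (s ∩ Set.Ici 0) := by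
    congr 1
    ext x
    simp only [Set.mem_inter_iff, Set.mem_preimage, Set.mem_Ici]
    exact and_congr_left fun hx => by rw [abs_of_nonneg hx]
  have hneg : volume ((fun x : ℝ => |x|) ⁻¹' s \ Set.Ici 0) = volume (s ∩ Set.Ici 0) := by
    rw [← Measure.measure_neg volume (s ∩ Set.Ici 0)]
    refine measure_congr ?_
    have : ∀ᵐ x : ℝ, x ≠ 0 := by
      rw [ae_iff]; simp
    filter_upwards [this] with x hx
    apply propext
    change (|x| ∈ s ∧ ¬ (0 ≤ x)) ↔ (-x ∈ s ∧ 0 ≤ -x)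
    constructor
    · rintro ⟨h1, h2⟩
      rw [abs_of_neg (not_le.1 h2)] at h1
      exact ⟨h1, by linarith⟩
    · rintro ⟨h1, h2⟩
      have h3 : x < 0 := lt_of_le_of_ne (by linarith) hx
      rw [abs_of_neg h3]
      exact ⟨h1, by linarith⟩
  rw [Measure.map_apply hm hs, ← measure_inter_add_sdiff _ measurableSet_Ici, hpos, hneg,
    Measure.smul_apply, Measure.restrict_apply hs, ENNReal.smul_def, smul_eq_mul, ← two_mul]
  simp

theorem integral_orthant_fun_norm {ι : Type*} [Fintype ι] [Nonempty ι] {f : ℝ → ℝ}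
    (hf : Measurable f) :
    2 ^ Fintype.card ι * ∫ y in Set.univ.pi fun _ : ι => Set.Ici (0 : ℝ), f √(∑ i, y i ^ 2) =
      Fintype.card ι * (volume.real (Metric.ball (0 : EuclideanSpace ℝ ι) 1) *
        ∫ r in Set.Ioi (0 : ℝ), r ^ (Fintype.card ι - 1) * f r) := by
  have hF : Measurable fun y : ι → ℝ => f √(∑ i, y i ^ 2) := by fun_prop
  have h1 := integral_fun_norm_addHaar (volume : Measure (EuclideanSpace ℝ ι)) f
  rw [← (PiLp.volume_preserving_toLp ι).integral_comp (MeasurableEquiv.toLp 2 _).measurableEmbedding]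
    at h1
  simp only [EuclideanSpace.norm_eq, finrank_euclideanSpace, smul_eq_mul, nsmul_eq_mul,
    Real.norm_eq_abs, sq_abs] at h1
  rw [← h1, volume_pi, Measure.restrict_pi_pi]
  have h2 := map_pi_eq_smul_pi (ι := ι) (T := fun _ x => |x|) (fun _ => by fun_prop)
    fun _ => map_abs_volume
  have h3 := integral_map (μ := (volume : Measure (ι → ℝ))) (φ := fun y i => |y i|)
    (by fun_prop : Measurable fun (y : ι → ℝ) i => |y i|).aemeasurable hF.aestronglyMeasurable
  simp only [sq_abs] at h3
  rw [← volume_pi, ← h3, h2, integral_smul_nnreal_measure]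
  simp [NNReal.smul_def]

/-- Volume of the orthant of a `2 * N`-dimensional ball of squared radius `(N + 1) / 2`. -/
noncomputable def orthantVolume (N : ℕ) : ℝ :=
  (Real.pi / 8) ^ N * (N + 1) ^ N / N.factorial

theorem HasRegion.orthant {ι : Type} [Fintype ι] {lo hi : ι → ℝ} {N : ℕ}
    (hN : Fintype.card ι = 2 * N) (hlo : ∀ i, lo i ≤ 0) (hhi : ∀ i, √((N + 1) / 2) ≤ hi i) :
    HasRegion lo hi (orthantVolume N) (∑ _i : ι, (1 / 4 : ℝ)) := by
  rcases isEmpty_or_nonempty ι with h | h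
  · have : N = 0 := by simpa using hN
    subst this
    simpa [orthantVolume] using HasRegion.of_isEmpty (lo := lo) (hi := hi)
  have hN0 : 0 < N := by have := Fintype.card_pos (α := ι); omega
  set R := √(((N : ℝ) + 1) / 2) with hR
  have hR0 : 0 ≤ R := Real.sqrt_nonneg _
  have hR2 : R ^ 2 = (N + 1) / 2 := Real.sq_sqrt (by positivity)
  set O := Set.univ.pi fun _ : ι => Set.Ici (0 : ℝ) with hO
  set B := {y : ι → ℝ | √(∑ i, y i ^ 2) ≤ R} with hB
  have hBm : MeasurableSet B := measurableSet_le (by fun_prop) measurable_const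
  have hOm : MeasurableSet O := MeasurableSet.univ_pi fun _ => measurableSet_Ici
  have hball : volume.real (Metric.ball (0 : EuclideanSpace ℝ ι) 1) = Real.pi ^ N / N.factorial := by
    rw [measureReal_def, InnerProductSpace.volume_ball_of_dim_even (k := N) (by simp [hN])]
    simp
    positivity
  have hint : ∀ m : ℕ, ∫ y in O ∩ B, √(∑ i, y i ^ 2) ^ m =
      (1 / 2) ^ (2 * N) * (2 * N * (Real.pi ^ N / N.factorial * (R ^ (2 * N + m) / (2 * N + m)))) := by
    intro m
    have h1 := integral_orthant_fun_norm (ι := ι)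
      (f := (Set.Iic R).indicator fun r => r ^ m)
      ((by fun_prop : Measurable fun r : ℝ => r ^ m).indicator measurableSet_Iic)
    have h2 : ∫ y in O, (Set.Iic R).indicator (fun r => r ^ m) √(∑ i, y i ^ 2) =
        ∫ y in O ∩ B, √(∑ i, y i ^ 2) ^ m := by
      rw [Set.inter_comm, ← Measure.restrict_restrict hBm, ← integral_indicator hBm]
      rfl
    have h3 : ∫ r in Set.Ioi (0 : ℝ), r ^ (Fintype.card ι - 1) *
        (Set.Iic R).indicator (fun r => r ^ m) r = R ^ (2 * N + m) / (2 * N + m) := by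
      have : ∀ r : ℝ, r ^ (Fintype.card ι - 1) * (Set.Iic R).indicator (fun r => r ^ m) r =
          (Set.Iic R).indicator (fun r => r ^ (2 * N - 1 + m)) r := by
        intro r
        rw [hN, Set.indicator_apply, Set.indicator_apply]
        split_ifs
        · rw [pow_add]
        · simp
      simp only [this]
      rw [integral_indicator measurableSet_Iic, Measure.restrict_restrict measurableSet_Iic,
        Set.inter_comm, Set.Ioi_inter_Iic, ← intervalIntegral.integral_of_le hR0, integral_pow]
      have e : 2 * N - 1 + m + 1 = 2 * N + m := by omega
      have e2 : ((2 * N - 1 + m : ℕ) : ℝ) + 1 = 2 * N + m := by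
        rw [← Nat.cast_succ, Nat.succ_eq_add_one, e]; push_cast; ring
      rw [e2, e]
      simp [show N ≠ 0 by omega]
    rw [← h2, one_div, inv_pow, eq_inv_mul_iff_mul_eq₀ (by positivity), ← hN, h1, h3, hball, hN]
    push_cast
    ring
  have hsub : O ∩ B ⊆ Set.Icc lo hi := by
    rintro y ⟨hy1, hy2⟩
    have h0 : ∀ i, 0 ≤ y i := fun i => hy1 i trivial
    refine ⟨fun i => (hlo i).trans (h0 i), fun i => le_trans ?_ (hhi i)⟩
    refine le_trans (Real.le_sqrt_of_sq_le ?_) hy2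
    exact Finset.single_le_sum (f := fun i => y i ^ 2) (fun i _ => sq_nonneg _) (Finset.mem_univ i)
  have hvol : volume.real (O ∩ B) = orthantVolume N := by
    have := hint 0
    simp only [pow_zero, setIntegral_const, smul_eq_mul, mul_one] at this
    rw [this, orthantVolume, add_zero, pow_mul R, hR2, pow_mul]
    push_cast
    have h8 : (8 : ℝ) ^ N = 2 ^ N * 4 ^ N := by rw [← mul_pow]; norm_num
    rw [div_pow Real.pi, h8]
    have : (N : ℝ) ≠ 0 := by positivity
    norm_num [div_pow]
    field_simp
  refine ⟨O ∩ B, hOm.inter hBm, hsub, hvol.ge, ?_⟩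
  have h2 := hint 2
  have h0 := hint 0
  simp only [pow_zero, setIntegral_const, smul_eq_mul, mul_one] at h0
  have hsq : ∀ y : ι → ℝ, √(∑ i, y i ^ 2) ^ 2 = ∑ i, y i ^ 2 := fun y =>
    Real.sq_sqrt (Finset.sum_nonneg fun i _ => sq_nonneg _)
  simp only [hsq] at h2
  rw [h2, h0, pow_add R, hR2]
  simp only [Finset.sum_const, Finset.card_univ, hN, nsmul_eq_mul]
  apply le_of_eq
  have : (N : ℝ) ≠ 0 := by positivity
  push_cast
  field_simp
  ring

theorem orthantVolume_le_succ {N : ℕ} (hN : 7 ≤ N) : orthantVolume N ≤ orthantVolume (N + 1) := by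
  have hx : (8 : ℝ) ≤ N + 1 := by
    have : (7 : ℝ) ≤ N := by exact_mod_cast hN
    linarith
  have hx0 : (0 : ℝ) < N + 1 := by linarith
  have hlog : 16 / 17 ≤ ((N : ℝ) + 1) * Real.log (1 + 1 / (N + 1)) := by
    have h := Real.le_log_one_add_of_nonneg (x := 1 / ((N : ℝ) + 1)) (by positivity)
    refine le_trans ?_ (mul_le_mul_of_nonneg_left h hx0.le)
    have : ((N : ℝ) + 1) * (2 * (1 / (N + 1)) / (1 / (N + 1) + 2)) =
        2 * (N + 1) / (2 * (N + 1) + 1) := by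
      field_simp
      ring
    rw [this, div_le_div_iff₀ (by norm_num) (by positivity)]
    linarith
  have hexp : 8 / Real.pi ≤ Real.exp (16 / 17) := by
    have h1 : Real.exp 1 * (16 / 17) ≤ Real.exp (16 / 17) := by
      have h2 : (16 / 17 : ℝ) ≤ Real.exp (16 / 17 - 1) := by
        have := Real.add_one_le_exp (16 / 17 - 1 : ℝ)
        linarith
      have h3 := mul_le_mul_of_nonneg_left h2 (Real.exp_pos 1).le
      rwa [← Real.exp_add, show (1 : ℝ) + (16 / 17 - 1) = 16 / 17 by norm_num] at h3
    refine le_trans ?_ h1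
    have := Real.exp_one_gt_d9
    have := Real.pi_gt_d4
    rw [div_le_iff₀ Real.pi_pos]
    nlinarith
  have hpow : 8 / Real.pi ≤ ((N + 2) / (N + 1) : ℝ) ^ (N + 1) := by
    have h1 : ((N + 2) / (N + 1) : ℝ) = 1 + 1 / (N + 1) := by field_simp; ring
    have h2 : (0 : ℝ) < 1 + 1 / (N + 1) := by positivity
    rw [h1, ← Real.exp_log (pow_pos h2 _), Real.log_pow]
    refine hexp.trans (Real.exp_le_exp.2 ?_)
    push_cast
    exact hlog
  rw [div_pow, le_div_iff₀ (by positivity), div_mul_eq_mul_div, div_le_iff₀ Real.pi_pos] at hpow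
  unfold orthantVolume
  rw [div_le_div_iff₀ (by positivity) (by positivity), Nat.factorial_succ]
  push_cast
  rw [pow_succ (Real.pi / 8)]
  have h := mul_le_mul_of_nonneg_left hpow
    (show 0 ≤ (Real.pi / 8) ^ N * N.factorial / 8 by positivity)
  calc (Real.pi / 8) ^ N * ((N : ℝ) + 1) ^ N * ((N + 1) * N.factorial)
      = (Real.pi / 8) ^ N * N.factorial / 8 * (8 * (N + 1 : ℝ) ^ (N + 1)) := by ring
    _ ≤ _ := h
    _ = _ := by ring

theorem two_thirds_le_orthantVolume {N : ℕ} (hN : N ≤ 2) : 2 / 3 ≤ orthantVolume N := by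
  have h := Real.pi_gt_d4
  have h2 : 3.1415 ^ N ≤ Real.pi ^ N := by gcongr
  unfold orthantVolume
  interval_cases N <;> norm_num [Nat.factorial, div_pow] at h2 ⊢ <;> linarith

theorem one_le_sqrt_three_mul_orthantVolume (N : ℕ) : 1 ≤ √3 * orthantVolume N := by
  have h : (0.578 : ℝ) ≤ orthantVolume N := by
    rcases le_total N 7 with hN | hN
    · have h := Real.pi_gt_d4
      have h2 : 3.1415 ^ N ≤ Real.pi ^ N := by gcongr
      unfold orthantVolume
      interval_cases N <;> norm_num [Nat.factorial, div_pow] at h2 ⊢ <;> linarith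
    · induction N, hN using Nat.le_induction with
      | base =>
        have h := Real.pi_gt_d4
        have h2 : 3.1415 ^ 7 ≤ Real.pi ^ 7 := by gcongr
        unfold orthantVolume
        norm_num [Nat.factorial, div_pow] at h2 ⊢
        linarith
      | succ N hN ih => exact ih.trans (orthantVolume_le_succ hN)
  have h3 : (1.732 : ℝ) ≤ √3 := Real.le_sqrt_of_sq_le (by norm_num)
  nlinarith

theorem HasRegion.split_sum {ι : Type} [Fintype ι] {lo hi : ι → ℝ} (p : ι → Prop)
    [DecidablePred p] [f₁ : Fintype {i // p i}] [f₂ : Fintype {i // ¬ p i}] {V₁ V₂ c : ℝ} (hV₂ : 0 ≤ V₂)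
    (h₁ : HasRegion (fun i : {i // p i} => lo i) (fun i => hi i) V₁ (∑ _i : {i // p i}, c))
    (h₂ : HasRegion (fun i : {i // ¬ p i} => lo i) (fun i => hi i) V₂ (∑ _i : {i // ¬ p i}, c)) :
    HasRegion lo hi (V₁ * V₂) (∑ _i : ι, c) := by
  obtain rfl := Subsingleton.elim f₁ (Subtype.fintype _)
  obtain rfl := Subsingleton.elim f₂ (Subtype.fintype _)
  rw [← Fintype.sum_subtype_add_sum_subtype p]
  exact HasRegion.split p hV₂ h₁ h₂

theorem HasRegion.subtype_eq {ι : Type} [Fintype ι] [DecidableEq ι] {lo hi : ι → ℝ} (i : ι)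
    {s t e : ℝ} (hst : s ≤ t) (hlo : lo i ≤ s) (hhi : t ≤ hi i)
    (he : (t ^ 3 - s ^ 3) / 3 ≤ e * (t - s)) :
    HasRegion (fun j : {j // j = i} => lo j) (fun j => hi j) (t - s)
      (∑ _j : {j // j = i}, e) := by
  simpa using HasRegion.pi_Icc (lo := fun j : {j // j = i} => lo j) (hi := fun j => hi j)
    (fun _ => s) (fun _ => t) (fun _ => e) (fun _ => hst) (fun j => by rw [j.2]; exact hlo)
    (fun j => by rw [j.2]; exact hhi)
    fun _ => he

theorem hasRegion_of_window_le_sqrt_three {ι : Type} [Fintype ι] {L : ℝ} (hL : 1 ≤ L)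
    (hL3 : L ^ 2 ≤ 3) {δ m : ι → ℝ} (hδ : ∀ i, 0 ≤ δ i) (hδm : ∀ i, δ i ≤ 2 * m i)
    (hm : ∀ i, m i ≤ L / 2) (hsum : 0 ≤ ∑ i, (δ i ^ 2 - 1)) :
    HasRegion (fun i => -m i) (fun i => L - m i) (3 / 4) (∑ _i : ι, (1 / 4 : ℝ)) := by
  have h := HasRegion.pi_Icc (lo := fun i => -m i) (hi := fun i => L - m i)
    (fun i => -min (m i) (1 / 2)) (fun i => 1 - min (m i) (1 / 2))
    (fun i => 1 / 3 - δ i ^ 2 / 12) (fun i => by linarith)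
    (fun i => neg_le_neg (min_le_left _ _))
    (fun i => by
      have := hm i
      rcases min_cases (m i) (1 / 2) with ⟨h, _⟩ | ⟨h, _⟩ <;> rw [h] <;> linarith)
    (fun i => by
      have h0 := hδ i
      have h1 := hδm i
      have h2 := hm i
      rcases min_cases (m i) (1 / 2) with ⟨h, h'⟩ | ⟨h, h'⟩ <;> rw [h] <;> nlinarith)
  refine h.mono (by norm_num) ?_
  have h4 : ∑ i : ι, (1 / 4 : ℝ) - ∑ i, (1 / 3 - δ i ^ 2 / 12) =
      (∑ i, (δ i ^ 2 - 1)) / 12 := by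
    rw [← Finset.sum_sub_distrib, Finset.sum_div]
    exact Finset.sum_congr rfl fun i _ => by ring
  linarith

theorem hasRegion_of_window {L : ℝ} (hL : 1 ≤ L) (n : ℕ) :
    ∀ (ι : Type) [Fintype ι], Fintype.card ι = n → ∀ δ m : ι → ℝ, (∀ i, 0 ≤ δ i) →
      (∀ i, δ i ≤ 2 * m i) → (∀ i, m i ≤ L / 2) → 0 ≤ ∑ i, (δ i ^ 2 - 1) →
      HasRegion (fun i => -m i) (fun i => L - m i) (3 / 4) (∑ _i : ι, (1 / 4 : ℝ)) := by
  rcases le_or_gt (L ^ 2) 3 with hL3 | hL3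
  · intro ι _ _ δ m
    exact hasRegion_of_window_le_sqrt_three hL hL3
  have hs3 : √3 ^ 2 = (3 : ℝ) := Real.sq_sqrt (by norm_num)
  have hs0 : 0 < √(3 : ℝ) := by positivity
  have hLs : √3 ≤ L := Real.sqrt_le_iff.2 ⟨by linarith, hL3.le⟩
  have hs1 : (1.7 : ℝ) ≤ √3 := Real.le_sqrt_of_sq_le (by norm_num)
  induction n using Nat.strong_induction_on with
  | _ n ih =>
  intro ι _ hn δ m hδ hδm hm hsum
  classical
  rcases isEmpty_or_nonempty ι with hι | hι
  · exact HasRegion.of_isEmpty.mono (by norm_num) (by simp)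
  obtain ⟨a, ha⟩ : ∃ a, 1 ≤ δ a ^ 2 := by
    by_contra! h
    have : ∑ i, (δ i ^ 2 - 1) < 0 :=
      Finset.sum_neg (fun i _ => by linarith [h i]) Finset.univ_nonempty
    linarith
  have hma : 1 / 2 ≤ m a := by nlinarith [hδ a, hδm a]
  have hm0 : ∀ i, 0 ≤ m i := fun i => by linarith [hδ i, hδm i]
  set N := ⌊δ a ^ 2⌋₊ with hN
  have hN1 : 1 ≤ N := Nat.le_floor (by simpa using ha)
  have hNle : (N : ℝ) ≤ δ a ^ 2 := Nat.floor_le (sq_nonneg _)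
  have hNlt : δ a ^ 2 < N + 1 := Nat.lt_floor_add_one _
  have hNL : (N : ℝ) ≤ L ^ 2 := hNle.trans (by nlinarith [hδ a, hδm a, hm a])
  set Z := Finset.univ.filter fun i => m i < 1 / 4 with hZ
  have horth : ∀ (S : Finset ι) (N' : ℕ), S ⊆ Z → S.card = 2 * N' → N' ≤ N →
      ∀ _ : Fintype {i // i ∈ S},
      HasRegion (fun i : {i // i ∈ S} => -m i) (fun i => L - m i) (orthantVolume N')
        (∑ _i : {i // i ∈ S}, (1 / 4 : ℝ)) := by
    intro S N' hS hc hle _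
    refine HasRegion.orthant (hc ▸ Fintype.card_of_subtype S fun _ => Iff.rfl) (fun i => by linarith [hm0 i]) fun i => ?_
    have h1 : m i < 1 / 4 := (Finset.mem_filter.1 (hS i.2)).2
    have h2 : (N' : ℝ) ≤ N := by exact_mod_cast hle
    refine Real.sqrt_le_iff.2 ⟨by linarith, ?_⟩
    nlinarith
  have haS : ∀ S : Finset ι, S ⊆ Z → a ∉ S := fun S hS h => by
    have := (Finset.mem_filter.1 (hS h)).2
    linarith
  have hshort : ∀ κ : Type, ∀ _ : Fintype κ, ∀ (f : κ → ι) (b : κ), f b = a →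
      HasRegion (fun j : {j // j = b} => -m (f j)) (fun j => L - m (f j)) (3 / 2)
        (∑ _j : {j // j = b}, (1 / 4 : ℝ)) := by
    intro κ _ f b hb
    have h := HasRegion.subtype_eq (lo := fun j => -m (f j)) (hi := fun j => L - m (f j)) b
      (s := -min (m a) (3 / 4)) (t := 3 / 2 - min (m a) (3 / 4)) (e := 1 / 4) (by linarith)
      (by rw [hb]; exact neg_le_neg (min_le_left _ _))
      (by
        have := hm a
        rw [hb]
        rcases min_cases (m a) (3 / 4) with ⟨h, _⟩ | ⟨h, _⟩ <;> rw [h] <;> linarith)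
      (by rcases min_cases (m a) (3 / 4) with ⟨h, h'⟩ | ⟨h, h'⟩ <;> rw [h] <;> nlinarith)
    exact h.mono (by linarith) le_rfl
  rcases le_or_gt (2 * N) Z.card with hcard | hcard
  · obtain ⟨S, hS, hSc⟩ := Finset.exists_subset_card_eq hcard
    have hsingle : ∃ ℓ : ℝ, 1 ≤ orthantVolume N * ℓ ∧ 0 ≤ ℓ ∧
        HasRegion (fun j : {j : {i // i ∉ S} // j = ⟨a, haS S hS⟩} => -m j.1)
          (fun j => L - m j.1) ℓ (∑ _j : {j : {i // i ∉ S} // j = ⟨a, haS S hS⟩}, (1 / 4 : ℝ)) := by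
      rcases le_or_gt N 2 with hN2 | hN2
      · exact ⟨3 / 2, by linarith [two_thirds_le_orthantVolume hN2], by norm_num,
          hshort {i // i ∉ S} inferInstance Subtype.val ⟨a, haS S hS⟩ rfl⟩
      · have h3 : (3 : ℝ) ≤ δ a ^ 2 := le_trans (by exact_mod_cast hN2) hNle
        have h4 : √3 / 2 ≤ m a := by
          have : √3 ≤ δ a := Real.sqrt_le_iff.2 ⟨hδ a, h3⟩
          linarith [hδm a]
        refine ⟨√3, by linarith [one_le_sqrt_three_mul_orthantVolume N], hs0.le, ?_⟩
        have h := HasRegion.subtype_eq (lo := fun j : {i // i ∉ S} => -m j)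
          (hi := fun j => L - m j) ⟨a, haS S hS⟩
          (s := -(√3 / 2)) (t := √3 / 2) (e := 1 / 4) (by linarith) (by simpa using h4)
          (by simp only; linarith [hm a])
          (by nlinarith)
        exact h.mono (by linarith) le_rfl
    obtain ⟨ℓ, hℓ, hℓ0, hreg⟩ := hsingle
    have hrest : HasRegion (fun j : {j : {i // i ∉ S} // ¬ j = ⟨a, haS S hS⟩} => -m j.1)
        (fun j => L - m j.1) (3 / 4)
        (∑ _j : {j : {i // i ∉ S} // ¬ j = ⟨a, haS S hS⟩}, (1 / 4 : ℝ)) := by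
      refine ih _ ?_ _ rfl (fun j => δ j.1) _ (fun j => hδ _) (fun j => hδm _) (fun j => hm _) ?_
      · rw [← hn]
        refine (Fintype.card_subtype_lt (x := ⟨a, haS S hS⟩) (by simp)).trans_le ?_
        exact Fintype.card_subtype_le _
      · have h1 : ∑ i : {i // i ∈ S}, (δ i ^ 2 - 1) + ∑ i : {i // i ∉ S}, (δ i ^ 2 - 1) =
            ∑ i, (δ i ^ 2 - 1) := by
          convert Fintype.sum_subtype_add_sum_subtype (fun i => i ∈ S) fun i => δ i ^ 2 - 1
        have h2 : ∑ j : {j : {i // i ∉ S} // j = ⟨a, haS S hS⟩}, (δ j.1 ^ 2 - 1) +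
            ∑ j : {j : {i // i ∉ S} // ¬ j = ⟨a, haS S hS⟩}, (δ j.1 ^ 2 - 1) =
            ∑ i : {i // i ∉ S}, (δ i ^ 2 - 1) := by
          convert Fintype.sum_subtype_add_sum_subtype
            (fun j : {i // i ∉ S} => j = ⟨a, haS S hS⟩) fun j => δ j ^ 2 - 1
        have h3 : ∑ j : {j : {i // i ∉ S} // j = ⟨a, haS S hS⟩}, (δ j.1 ^ 2 - 1) = δ a ^ 2 - 1 :=
          Fintype.sum_subsingleton (fun j : {j : {i // i ∉ S} // j = ⟨a, haS S hS⟩} =>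
            δ j.1 ^ 2 - 1) ⟨⟨a, haS S hS⟩, rfl⟩
        have h4 : ∑ i : {i // i ∈ S}, (δ i ^ 2 - 1) ≤ ∑ i : {i // i ∈ S}, (-(3 / 4) : ℝ) := by
          refine Finset.sum_le_sum fun i _ => ?_
          have := (Finset.mem_filter.1 (hS i.2)).2
          nlinarith [hδ i, hδm i]
        have h5 : ∑ i : {i // i ∈ S}, (-(3 / 4) : ℝ) = 2 * N * -(3 / 4) := by
          simp [hSc]
        have h6 : (1 : ℝ) ≤ N := by exact_mod_cast hN1
        linarith
    have h := HasRegion.split_sum (lo := fun j : {i // i ∉ S} => -m j) (hi := fun j => L - m j)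
      (fun j => j = ⟨a, haS S hS⟩) (by norm_num) hreg hrest
    have h := HasRegion.split_sum (lo := fun i => -m i) (hi := fun i => L - m i)
      (fun i => i ∈ S) (mul_nonneg hℓ0 (by norm_num)) (horth S N hS hSc le_rfl _) h
    exact h.mono (by nlinarith) le_rfl
  · set N' := Z.card / 2 with hN'
    obtain ⟨S, hS, hSc⟩ := Finset.exists_subset_card_eq (show 2 * N' ≤ Z.card by omega)
    have hdiff : (Z \ S).card ≤ 1 := by
      have := Finset.card_sdiff_add_card_eq_card hS
      omega
    have hrest : HasRegion (fun j : {j : {i // i ∉ S} // ¬ j = ⟨a, haS S hS⟩} => -m j.1)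
        (fun j => L - m j.1) (√3 / 2)
        (∑ _j : {j : {i // i ∉ S} // ¬ j = ⟨a, haS S hS⟩}, (1 / 4 : ℝ)) := by
      have h := HasRegion.pi_Icc
        (lo := fun j : {j : {i // i ∉ S} // ¬ j = ⟨a, haS S hS⟩} => -m j.1)
        (hi := fun j => L - m j.1)
        (fun j => if m j.1 < 1 / 4 then 0 else -min (m j.1) (1 / 2))
        (fun j => if m j.1 < 1 / 4 then √3 / 2 else 1 - min (m j.1) (1 / 2))
        (fun j => 1 / 4) (fun j => by split_ifs <;> linarith)
        (fun j => by
          split_ifs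
          · linarith [hm0 j.1]
          · exact neg_le_neg (min_le_left _ _))
        (fun j => by
          split_ifs
          · linarith
          · have := hm j.1
            rcases min_cases (m j.1) (1 / 2) with ⟨h, _⟩ | ⟨h, _⟩ <;> rw [h] <;> linarith)
        (fun j => by
          split_ifs
          · nlinarith
          · rcases min_cases (m j.1) (1 / 2) with ⟨h, h'⟩ | ⟨h, h'⟩ <;> rw [h] <;> nlinarith)
      refine h.mono ?_ le_rfl
      have hlen : ∀ j : {j : {i // i ∉ S} // ¬ j = ⟨a, haS S hS⟩},
          (if m j.1 < 1 / 4 then √3 / 2 else 1 - min (m j.1) (1 / 2)) -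
            (if m j.1 < 1 / 4 then 0 else -min (m j.1) (1 / 2)) =
          if m j.1 < 1 / 4 then √3 / 2 else 1 := by
        intro j
        split_ifs <;> ring
      simp only [hlen]
      rw [Finset.prod_ite, Finset.prod_const, Finset.prod_const_one, mul_one]
      have hle : √3 / 2 ≤ 1 := by nlinarith
      refine (pow_one (√3 / 2)).symm.le.trans (pow_le_pow_of_le_one (by positivity) hle ?_)
      refine Finset.card_le_one.2 fun j hj j' hj' => ?_
      have hmem : ∀ j : {j : {i // i ∉ S} // ¬ j = ⟨a, haS S hS⟩}, m j.1 < 1 / 4 →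
          (j.1 : ι) ∈ Z \ S := fun j h =>
        Finset.mem_sdiff.2 ⟨Finset.mem_filter.2 ⟨Finset.mem_univ _, h⟩, j.1.2⟩
      exact Subtype.ext (Subtype.ext (Finset.card_le_one.1 hdiff _
        (hmem j (Finset.mem_filter.1 hj).2) _ (hmem j' (Finset.mem_filter.1 hj').2)))
    have h := HasRegion.split_sum (lo := fun j : {i // i ∉ S} => -m j) (hi := fun j => L - m j)
      (fun j => j = ⟨a, haS S hS⟩) (by positivity)
      (hshort {i // i ∉ S} inferInstance Subtype.val ⟨a, haS S hS⟩ rfl) hrest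
    have h := HasRegion.split_sum (lo := fun i => -m i) (hi := fun i => L - m i)
      (fun i => i ∈ S) (by positivity) (horth S N' hS hSc (by omega) _) h
    exact h.mono (by linarith [one_le_sqrt_three_mul_orthantVolume N']) le_rfl

theorem sqrt_one_add_two_div_pow_le {k : ℕ} (hk : 1 ≤ k) :
    √((k + 2) / k) ^ k ≤ (3 * (k + 1) / (k + 2) : ℝ) := by
  have hk0 : (0 : ℝ) < k := by exact_mod_cast hk
  rcases le_or_gt k 8 with h | h
  · refine (sq_le_sq₀ (by positivity) (by positivity)).1 ?_
    rw [← pow_mul, mul_comm, pow_mul, Real.sq_sqrt (by positivity)]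
    interval_cases k <;> norm_num
  · have h9 : (9 : ℝ) ≤ k := by exact_mod_cast h
    have h1 : √(((k : ℝ) + 2) / k) ≤ Real.exp (1 / k) := by
      refine le_trans ?_ (Real.add_one_le_exp _)
      refine Real.sqrt_le_iff.2 ⟨by positivity, ?_⟩
      have : ((k : ℝ) + 2) / k = 1 + 2 * (1 / k) := by field_simp
      rw [this]
      nlinarith [sq_nonneg (1 / (k : ℝ))]
    calc √(((k : ℝ) + 2) / k) ^ k ≤ Real.exp (1 / k) ^ k := by gcongr
      _ = Real.exp 1 := by rw [← Real.exp_nat_mul]; congr 1; field_simp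
      _ ≤ 2.7182818286 := Real.exp_one_lt_d9.le
      _ ≤ _ := by rw [le_div_iff₀ (by positivity)]; linarith

theorem map_affine_volume {α : NNReal} (hα : α ≠ 0) (c ε : ℝ) (hε : |ε| = 1) :
    Measure.map (fun y : ℝ => c + α * ε * y) volume = α⁻¹ • volume := by
  have hε0 : ε ≠ 0 := by rintro rfl; simp at hε
  have hα0 : (α : ℝ) ≠ 0 := by exact_mod_cast hα
  have h : (fun y : ℝ => c + α * ε * y) = (fun y => c + y) ∘ fun y => α * ε * y := rfl
  rw [h, ← Measure.map_map (by fun_prop) (by fun_prop),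
    Real.map_volume_mul_left (mul_ne_zero hα0 hε0), Measure.map_smul,
    map_add_left_eq_self, abs_inv, abs_mul, hε, mul_one, NNReal.abs_eq, ← NNReal.coe_inv,
    ENNReal.ofReal_coe_nnreal]
  rfl

theorem le_integral_posPart {ι : Type} [Fintype ι] [Nonempty ι] {a b : ι → ℝ}
    (ha : ∀ i, a i ∈ Set.Icc (0 : ℝ) 1) (hb : ∀ i, b i ∈ Set.Icc (0 : ℝ) 1)
    (hab : 0 < ∑ i, (a i - b i) ^ 2) :
    √((∑ i, (a i - b i) ^ 2) / Fintype.card ι) ^ Fintype.card ι / (2 * (Fintype.card ι + 1)) ≤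
      ∫ x in Set.Icc (0 : ι → ℝ) 1,
        max 0 (4 * (∑ i, (x i - a i) * (b i - x i)) / ∑ i, (a i - b i) ^ 2) := by
  set d := ∑ i, (a i - b i) ^ 2 with hd
  set k := Fintype.card ι with hk
  have hk1 : 1 ≤ k := Fintype.card_pos
  have hk0 : (0 : ℝ) < k := by exact_mod_cast hk1
  set F : (ι → ℝ) → ℝ := fun x => max 0 (4 * (∑ i, (x i - a i) * (b i - x i)) / d) with hF
  have hFc : Continuous F := by fun_prop
  have hdk : d ≤ k := by
    calc d ≤ ∑ _i : ι, (1 : ℝ) := Finset.sum_le_sum fun i _ => by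
          have := ha i; have := hb i
          simp only [Set.mem_Icc] at *
          nlinarith
      _ = k := by simp [hk]
  set α : NNReal := NNReal.sqrt (d / (k + 2)).toNNReal with hα
  have hα2 : (α : ℝ) ^ 2 = d / (k + 2) := by
    rw [hα, ← NNReal.coe_pow, NNReal.sq_sqrt, Real.coe_toNNReal _ (by positivity)]
  have hα0 : (0 : ℝ) < α := by
    refine lt_of_le_of_ne α.2 fun h => ?_
    rw [← h] at hα2
    have : 0 < d / (k + 2) := by positivity
    simp at hα2
    linarith
  have hα1 : (α : ℝ) ≤ 1 := by
    have : d / (k + 2) ≤ 1 := by rw [div_le_one (by positivity)]; linarith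
    nlinarith
  set c : ι → ℝ := fun i => (a i + b i) / 2 with hc
  set ε : ι → ℝ := fun i => if c i ≤ 1 / 2 then 1 else -1 with hε
  have hε1 : ∀ i, |ε i| = 1 := fun i => by simp only [hε]; split_ifs <;> simp
  set m : ι → ℝ := fun i => min (c i) (1 - c i) / α with hm
  set T : ι → ℝ → ℝ := fun i y => c i + α * ε i * y with hT
  have hreg := hasRegion_of_window (L := 1 / α) (by rwa [le_div_iff₀ hα0, one_mul]) k ι rfl
    (fun i => |a i - b i| / α) m (fun i => by positivity)
    (fun i => by
      have := ha i; have := hb i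
      simp only [Set.mem_Icc] at *
      rw [hm, ← mul_div_assoc, div_le_div_iff_of_pos_right hα0]
      rcases min_cases (c i) (1 - c i) with ⟨h, _⟩ | ⟨h, _⟩ <;> rw [h] <;>
        simp only [hc] <;> rw [abs_le] <;> constructor <;> linarith)
    (fun i => by
      rw [hm, div_div, mul_comm, ← div_div, div_le_div_iff_of_pos_right hα0]
      rcases min_cases (c i) (1 - c i) with ⟨h, _⟩ | ⟨h, _⟩ <;> rw [h] <;> linarith)
    (by
      simp only [Finset.sum_sub_distrib, div_pow, sq_abs, ← Finset.sum_div, ← hd, hα2]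
      rw [div_div_cancel₀ hab.ne']
      simp [← hk])
  obtain ⟨Q, hQm, hQs, hQV, hQe⟩ := hreg
  have hmaps : ∀ y ∈ Q, (fun i => T i (y i)) ∈ Set.Icc (0 : ι → ℝ) 1 := by
    intro y hy
    have key : ∀ i, 0 ≤ T i (y i) ∧ T i (y i) ≤ 1 := by
      intro i
      have h1 : -m i ≤ y i := (hQs hy).1 i
      have h2 : y i ≤ 1 / α - m i := (hQs hy).2 i
      have h3 : α * m i = min (c i) (1 - c i) := by simp only [hm]; field_simp
      have h4 := mul_le_mul_of_nonneg_left h1 hα0.le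
      have h5 := mul_le_mul_of_nonneg_left h2 hα0.le
      have h6 : (α : ℝ) * (1 / α) = 1 := by field_simp
      rw [mul_sub, h6] at h5
      rw [mul_neg] at h4
      simp only [hT, hε]
      rcases min_cases (c i) (1 - c i) with ⟨h, _⟩ | ⟨h, _⟩ <;> rw [h] at h3 <;>
        split_ifs <;> constructor <;> linarith
    exact ⟨fun i => (key i).1, fun i => (key i).2⟩
  have hTm : Measurable fun (y : ι → ℝ) i => T i (y i) := by fun_prop
  have hmap : Measure.map (fun (y : ι → ℝ) i => T i (y i)) volume = α⁻¹ ^ k • volume :=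
    map_pi_eq_smul_pi (ν := fun _ => volume) (fun i => by fun_prop) fun i =>
      map_affine_volume (by exact_mod_cast hα0.ne') _ _ (hε1 i)
  have hchange : ∫ x in Set.Icc (0 : ι → ℝ) 1, F x =
      α ^ k * ∫ y in (fun (y : ι → ℝ) i => T i (y i)) ⁻¹' Set.Icc 0 1, F fun i => T i (y i) := by
    rw [← setIntegral_map measurableSet_Icc hFc.aestronglyMeasurable hTm.aemeasurable, hmap,
      Measure.restrict_smul, integral_smul_nnreal_measure, NNReal.smul_def, smul_eq_mul,
      ← mul_assoc]
    push_cast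
    rw [← mul_pow, mul_inv_cancel₀ hα0.ne', one_pow, one_mul]
  have hpoint : ∀ y : ι → ℝ, 1 - 4 / (k + 2) * ∑ i, y i ^ 2 ≤ F fun i => T i (y i) := by
    intro y
    refine le_trans (le_of_eq ?_) (le_max_right _ _)
    have h1 : ∑ i, (T i (y i) - a i) * (b i - T i (y i)) = d / 4 - α ^ 2 * ∑ i, y i ^ 2 := by
      rw [hd, Finset.sum_div, Finset.mul_sum, ← Finset.sum_sub_distrib]
      refine Finset.sum_congr rfl fun i _ => ?_
      have h2 : ε i ^ 2 = 1 := by rw [← sq_abs, hε1, one_pow]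
      simp only [hT, hc]
      linear_combination (-(α : ℝ) ^ 2 * y i ^ 2) * h2
    rw [h1, hα2]
    field_simp
  have hmono : ∫ y in Q, (1 - 4 / (k + 2) * ∑ i, y i ^ 2) ≤
      ∫ y in (fun (y : ι → ℝ) i => T i (y i)) ⁻¹' Set.Icc 0 1, F fun i => T i (y i) := by
    have hint : IntegrableOn (fun y : ι → ℝ => F fun i => T i (y i))
        ((fun (y : ι → ℝ) i => T i (y i)) ⁻¹' Set.Icc 0 1) := by
      have h1 : IntegrableOn F (Set.Icc 0 1)
          (Measure.map (fun (y : ι → ℝ) i => T i (y i)) volume) := by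
        rw [hmap, IntegrableOn, Measure.restrict_smul]
        exact (integrableOn_of_subset_Icc hFc subset_rfl).smul_measure_nnreal
      rw [IntegrableOn, Measure.restrict_map hTm measurableSet_Icc] at h1
      exact h1.comp_measurable hTm
    refine le_trans (setIntegral_mono ?_ (hint.mono_set hmaps) hpoint)
      (setIntegral_mono_set hint (Filter.Eventually.of_forall fun y => le_max_left _ _)
        (Filter.Eventually.of_forall hmaps))
    exact integrableOn_of_subset_Icc (by fun_prop) hQs
  have hQint : ∫ y in Q, (1 - 4 / (k + 2) * ∑ i, y i ^ 2) =
      volume.real Q - 4 / (k + 2) * ∫ y in Q, ∑ i, y i ^ 2 := by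
    rw [integral_sub (integrableOn_of_subset_Icc continuous_const hQs)
      (integrableOn_of_subset_Icc (by fun_prop) hQs), integral_const_mul]
    simp
  have hlower : 3 / 2 / (k + 2) ≤ ∫ y in Q, (1 - 4 / (k + 2) * ∑ i, y i ^ 2) := by
    rw [hQint]
    have h1 := mul_le_mul_of_nonneg_left hQe (show (0 : ℝ) ≤ 4 / (k + 2) by positivity)
    have h2 : ∑ _i : ι, (1 / 4 : ℝ) = k / 4 := by simp [← hk]; ring
    rw [h2] at h1
    have h3 : volume.real Q - 4 / (k + 2) * (k / 4 * volume.real Q) =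
        2 / (k + 2) * volume.real Q := by field_simp; ring
    have h4 := mul_le_mul_of_nonneg_left hQV (show (0 : ℝ) ≤ 2 / (k + 2) by positivity)
    have h5 : 2 / ((k : ℝ) + 2) * (3 / 4) = 3 / 2 / (k + 2) := by ring
    linarith
  have hroot : √(d / k) = α * √((k + 2) / k) := by
    rw [← Real.sqrt_sq hα0.le, hα2, ← Real.sqrt_mul (by positivity)]
    congr 1
    field_simp
  rw [hchange, hroot, mul_pow, mul_div_assoc]
  refine mul_le_mul_of_nonneg_left ?_ (by positivity)
  refine le_trans ?_ (hlower.trans hmono)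
  refine (div_le_div_of_nonneg_right (sqrt_one_add_two_div_pow_le hk1) (by positivity)).trans
    (le_of_eq ?_)
  field_simp

theorem sum_posPart_inner_le_one {E ι : Type*} [NormedAddCommGroup E] [InnerProductSpace ℝ E]
    [Fintype ι] {a b : ι → E} (hab : ∀ i, a i ≠ b i)
    (hmin : ∀ i j, i ≠ j →
      ‖a i - b i‖ ^ 2 + ‖a j - b j‖ ^ 2 ≤ ‖a i - a j‖ ^ 2 + ‖b i - b j‖ ^ 2 ∧
      ‖a i - b i‖ ^ 2 + ‖a j - b j‖ ^ 2 ≤ ‖a i - b j‖ ^ 2 + ‖b i - a j‖ ^ 2) (x : E) :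
    ∑ i, max 0 (4 * inner ℝ (x - a i) (b i - x) / ‖a i - b i‖ ^ 2) ≤ 1 := by
  have h := sum_posPart_le_one Finset.univ
    (fun i => (1 / 2 : ℝ) • ((a i - x) + (b i - x))) (fun i => ‖a i - b i‖ ^ 2 / 4)
    (fun i => inner ℝ (a i - x) (b i - x))
    (fun i _ => by have := norm_pos_iff.2 (sub_ne_zero.2 (hab i)); positivity)
    (fun i _ => by
      rw [← sub_sub_sub_cancel_right (a i) (b i) x, norm_sub_sq_real, real_inner_smul_left,
        real_inner_smul_right, real_inner_self_eq_norm_sq, norm_add_sq_real]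
      ring)
    (fun i _ j _ hij => by
      have := inner_add_le_of_norm_sub_sq_le (a i - x) (b i - x) (a j - x) (b j - x)
        (by simpa using (hmin i j hij).1) (by simpa using (hmin i j hij).2)
      rw [real_inner_smul_left, real_inner_smul_right]
      linarith)
  refine le_trans (le_of_eq (Finset.sum_congr rfl fun i _ => ?_)) h
  rw [← neg_sub (a i) x, inner_neg_left]
  congr 1
  ring

theorem sum_norm_sub_pow_le {k n : ℕ} (hk : 0 < k) {a b : Fin n → EuclideanSpace ℝ (Fin k)}
    (ha : ∀ j i, a j i ∈ Set.Icc (0 : ℝ) 1) (hb : ∀ j i, b j i ∈ Set.Icc (0 : ℝ) 1)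
    (hab : ∀ i, a i ≠ b i)
    (hmin : ∀ i j, i ≠ j →
      ‖a i - b i‖ ^ 2 + ‖a j - b j‖ ^ 2 ≤ ‖a i - a j‖ ^ 2 + ‖b i - b j‖ ^ 2 ∧
      ‖a i - b i‖ ^ 2 + ‖a j - b j‖ ^ 2 ≤ ‖a i - b j‖ ^ 2 + ‖b i - a j‖ ^ 2) :
    ∑ j, ‖a j - b j‖ ^ k ≤ 2 * (k + 1) * (k : ℝ) ^ ((k : ℝ) / 2) := by
  have : Nonempty (Fin k) := ⟨⟨0, hk⟩⟩
  have hk0 : (0 : ℝ) < k := by exact_mod_cast hk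
  have hnorm : ∀ j, ‖a j - b j‖ ^ 2 = ∑ i, (a j i - b j i) ^ 2 := fun j => by
    rw [EuclideanSpace.real_norm_sq_eq]; rfl
  set g : Fin n → (Fin k → ℝ) → ℝ := fun j x =>
    max 0 (4 * (∑ i, (x i - a j i) * (b j i - x i)) / ∑ i, (a j i - b j i) ^ 2) with hg
  have hpoint : ∀ x : Fin k → ℝ, ∑ j, g j x ≤ 1 := by
    intro x
    refine le_trans (le_of_eq (Finset.sum_congr rfl fun j _ => ?_))
      (sum_posPart_inner_le_one hab hmin (WithLp.toLp 2 x))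
    rw [hnorm, hg]
    simp [PiLp.inner_apply, mul_comm]
  have hgi : ∀ j, IntegrableOn (g j) (Set.Icc 0 1) := fun j =>
    integrableOn_of_subset_Icc (by fun_prop) subset_rfl
  have hint : ∑ j, ∫ x in Set.Icc 0 1, g j x ≤ 1 := by
    rw [← integral_finsetSum _ fun j _ => hgi j]
    have hvol : volume.real (Set.Icc (0 : Fin k → ℝ) 1) = 1 := by
      rw [measureReal_def, Real.volume_Icc_pi_toReal zero_le_one]
      simp
    calc ∫ x in Set.Icc 0 1, ∑ j, g j x ≤ ∫ _x in Set.Icc (0 : Fin k → ℝ) 1, (1 : ℝ) :=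
          integral_mono (integrable_finsetSum _ fun j _ => hgi j)
            (integrableOn_of_subset_Icc continuous_const subset_rfl) hpoint
      _ = 1 := by simp [hvol]
  have hedge : ∀ j, ‖a j - b j‖ ^ k ≤
      2 * (k + 1) * (k : ℝ) ^ ((k : ℝ) / 2) * ∫ x in Set.Icc 0 1, g j x := by
    intro j
    have hpos : 0 < ‖a j - b j‖ := norm_pos_iff.2 (sub_ne_zero.2 (hab j))
    have h := le_integral_posPart (ha j) (hb j) (by rw [← hnorm]; positivity)
    have hroot : √(k : ℝ) ^ k = (k : ℝ) ^ ((k : ℝ) / 2) := by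
      rw [Real.sqrt_eq_rpow, ← Real.rpow_mul_natCast hk0.le]
      congr 1
      ring
    change _ ≤ ∫ x in Set.Icc 0 1, g j x at h
    rw [← hnorm, Fintype.card_fin, Real.sqrt_div (sq_nonneg _), Real.sqrt_sq hpos.le, div_pow,
      hroot, div_div, div_le_iff₀ (by positivity)] at h
    linarith
  calc ∑ j, ‖a j - b j‖ ^ k
      ≤ ∑ j, 2 * (k + 1) * (k : ℝ) ^ ((k : ℝ) / 2) * ∫ x in Set.Icc 0 1, g j x :=
        Finset.sum_le_sum fun j _ => hedge j
    _ = 2 * (k + 1) * (k : ℝ) ^ ((k : ℝ) / 2) * ∑ j, ∫ x in Set.Icc 0 1, g j x := by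
        rw [Finset.mul_sum]
    _ ≤ _ := mul_le_of_le_one_right (by positivity) hint

theorem isPerfectMatching_image {k n : ℕ} {X : Finset (EuclideanSpace ℝ (Fin k))}
    [DecidableEq (EuclideanSpace ℝ (Fin k) × EuclideanSpace ℝ (Fin k))] (σ : Fin n × Bool ≃ X) :
    IsPerfectMatching X (Finset.univ.image fun j : Fin n =>
      ((σ (j, false) : EuclideanSpace ℝ (Fin k)), (σ (j, true) : EuclideanSpace ℝ (Fin k)))) := by
  constructor
  · simp
  · intro x hx
    obtain ⟨⟨j, c⟩, hj⟩ := σ.surjective ⟨x, hx⟩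
    have hx' : x = σ (j, c) := by rw [hj]
    refine ⟨(σ (j, false), σ (j, true)), ⟨by simp, ?_⟩, ?_⟩
    · cases c <;> simp [hx']
    · rintro e ⟨he, hxe⟩
      obtain ⟨l, -, rfl⟩ := Finset.mem_image.1 he
      simp only [hx', Subtype.val_inj, σ.injective.eq_iff, Prod.mk.injEq] at hxe
      have : j = l := by tauto
      rw [this]

theorem matching_upper_bound (k : ℕ) (X : Finset (EuclideanSpace ℝ (Fin k)))
    (hX : ∀ p ∈ X, ∀ i, p i ∈ Set.Icc (0 : ℝ) 1) (heven : Even X.card) :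
    ∃ M : Finset (EuclideanSpace ℝ (Fin k) × EuclideanSpace ℝ (Fin k)),
      IsPerfectMatching X M ∧
      ∑ e ∈ M, ‖e.1 - e.2‖ ^ k ≤ 2 * (k + 1) * (k : ℝ) ^ ((k : ℝ) / 2) := by
  classical
  obtain ⟨n, hn⟩ := heven
  have hequiv : Nonempty (Fin n × Bool ≃ X) :=
    ⟨Fintype.equivOfCardEq (by simp [hn]; ring)⟩
  obtain ⟨σ, hσ⟩ := exists_pairing (Subtype.val : X → EuclideanSpace ℝ (Fin k)) hequiv
  refine ⟨_, isPerfectMatching_image σ, ?_⟩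
  rw [Finset.sum_image fun i _ j _ h => by simpa using h]
  rcases Nat.eq_zero_or_pos k with rfl | hk
  · have hn0 : n = 0 := by
      by_contra h
      have := σ.injective (Subsingleton.elim
        (σ (⟨0, Nat.pos_of_ne_zero h⟩, false)) (σ (⟨0, Nat.pos_of_ne_zero h⟩, true)))
      simp at this
    subst hn0
    simp
  · exact sum_norm_sub_pow_le hk (fun j => hX _ (σ _).2) (fun j => hX _ (σ _).2)
      (fun j h => by simpa using σ.injective (Subtype.ext h)) hσ
end

section
/- For every finite set X in the unit cube [0,1]^k and every integer t >= 1, there exists a Hamiltonian cycle H on X with sum over edges e of H of |e|^k at most 2(2t+1) * (1 + 1/t)^{k/2} * k^{k/2}. -/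
/-- Cyclic successor on `Fin n`. -/
def nxt {n : ℕ} (i : Fin n) : Fin n := ⟨(i.val + 1) % n, Nat.mod_lt _ i.pos⟩

/-- `f` is a Hamiltonian cycle on the finite set `X`: a cyclic ordering of the points
of `X`, i.e. an injective enumeration of `X` by `Fin X.card`; its edges join `f i`
and `f (nxt i)`. -/
def IsHamCycle {k : ℕ} (X : Finset (EuclideanSpace ℝ (Fin k)))
    (f : Fin X.card → EuclideanSpace ℝ (Fin k)) : Prop :=
  Function.Injective f ∧ ∀ x, x ∈ X ↔ ∃ i, f i = x

lemma nxt_val_of_lt {n : ℕ} {i : Fin n} (h : i.val + 1 < n) : (nxt i).val = i.val + 1 :=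
  Nat.mod_eq_of_lt h

lemma nxt_val_of_eq {n : ℕ} {i : Fin n} (h : i.val + 1 = n) : (nxt i).val = 0 := by
  simp [nxt, h]

/-- The reversal of the segment `a < l < b` of `Fin n`, fixing everything else. -/
def segRev {n : ℕ} (a b : ℕ) (hb : b ≤ n) : Equiv.Perm (Fin n) :=
  Function.Involutive.toPerm
    (fun l => if h : a < l.val ∧ l.val < b then ⟨a + b - l.val, by omega⟩ else l) (by
      intro l
      by_cases h : a < l.val ∧ l.val < b
      · have h' : a < a + b - l.val ∧ a + b - l.val < b := by omega
        simp only [h, h', and_self, dite_true]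
        ext
        simp only
        omega
      · simp [h])

lemma segRev_val_of_mem {n a b : ℕ} (hb : b ≤ n) {l : Fin n} (h : a < l.val ∧ l.val < b) :
    (segRev a b hb l).val = a + b - l.val := by
  change (if h : a < l.val ∧ l.val < b then (⟨a + b - l.val, by omega⟩ : Fin n) else l).val = _
  rw [dif_pos h]

lemma segRev_of_notMem {n a b : ℕ} (hb : b ≤ n) {l : Fin n} (h : ¬ (a < l.val ∧ l.val < b)) :
    segRev a b hb l = l := by
  change (if h : a < l.val ∧ l.val < b then (⟨a + b - l.val, by omega⟩ : Fin n) else l) = _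
  exact dif_neg h

lemma segRev_cost {n : ℕ} (w : Fin n → Fin n → ℝ) (hw : ∀ a b, w a b = w b a)
    {i j : Fin n} (hij : i < j) :
    (∑ l, w (segRev i.val (j.val + 1) j.isLt l) (segRev i.val (j.val + 1) j.isLt (nxt l)))
        + (w i (nxt i) + w j (nxt j))
      = (∑ l, w l (nxt l)) + (w i j + w (nxt i) (nxt j)) := by
  classical
  set π := segRev i.val (j.val + 1) j.isLt with hπ
  set σ := segRev i.val j.val j.isLt.le with hσ
  have hij' : i.val < j.val := hij
  have hj := j.isLt
  have hne : i ≠ j := hij.ne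
  have hi1 : (nxt i).val = i.val + 1 := nxt_val_of_lt (by omega)
  have hσi : σ i = i := segRev_of_notMem _ (by omega)
  have hσj : σ j = j := segRev_of_notMem _ (by omega)
  have hπi : π i = i := segRev_of_notMem _ (by omega)
  have hπj : π j = nxt i := by
    ext; rw [segRev_val_of_mem _ (by omega)]; omega
  have hπi1 : π (nxt i) = j := by
    ext; rw [segRev_val_of_mem _ (by omega)]; omega
  have hπj1 : π (nxt j) = nxt j := by
    refine segRev_of_notMem _ ?_
    rcases lt_or_eq_of_le (Nat.succ_le_of_lt hj) with h | h
    · rw [nxt_val_of_lt h]; omega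
    · rw [nxt_val_of_eq h]; omega
  have key : ∀ l, l ≠ i → l ≠ j → w (π l) (π (nxt l)) = w (σ l) (nxt (σ l)) := by
    intro l hli hlj
    have hli' : l.val ≠ i.val := fun h => hli (Fin.ext h)
    have hlj' : l.val ≠ j.val := fun h => hlj (Fin.ext h)
    by_cases hl : i.val < l.val ∧ l.val < j.val
    · have h1 : (nxt l).val = l.val + 1 := nxt_val_of_lt (by omega)
      have hs : (σ l).val = i.val + j.val - l.val := segRev_val_of_mem _ hl
      have hs1 : (nxt (σ l)).val = i.val + j.val - l.val + 1 := by
        rw [nxt_val_of_lt (by omega), hs]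
      have e1 : π l = nxt (σ l) := by
        ext; rw [segRev_val_of_mem _ (by omega)]; omega
      have e2 : π (nxt l) = σ l := by
        ext; rw [segRev_val_of_mem _ (by omega)]; omega
      rw [e1, e2, hw]
    · rw [show σ l = l from segRev_of_notMem _ hl, show π l = l from segRev_of_notMem _ (by omega)]
      congr 1
      refine segRev_of_notMem _ ?_
      rcases lt_or_eq_of_le (Nat.succ_le_of_lt l.isLt) with h | h
      · rw [nxt_val_of_lt h]; omega
      · rw [nxt_val_of_eq h]; omega
  have hsplit : ∀ g : Fin n → ℝ, ∑ l, g l = g i + g j + ∑ l ∈ (Finset.univ.erase i).erase j, g l := by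
    intro g
    rw [← Finset.add_sum_erase _ _ (Finset.mem_univ i),
      ← Finset.add_sum_erase _ _ (Finset.mem_erase.2 ⟨hne.symm, Finset.mem_univ j⟩)]
    ring
  have h2 : ∑ l, w (σ l) (nxt (σ l)) = ∑ l, w l (nxt l) :=
    Equiv.sum_comp σ (fun l => w l (nxt l))
  have h3 : ∑ l ∈ (Finset.univ.erase i).erase j, w (π l) (π (nxt l))
      = ∑ l ∈ (Finset.univ.erase i).erase j, w (σ l) (nxt (σ l)) := by
    refine Finset.sum_congr rfl fun l hl => ?_
    simp only [Finset.mem_erase, Finset.mem_univ, and_true] at hl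
    exact key l hl.2 hl.1
  rw [hsplit] at h2
  rw [hsplit, h3, ← h2, hσi, hσj, hπi, hπj, hπi1, hπj1]
  ring

lemma exists_two_opt {E : Type*} [SeminormedAddCommGroup E] (X : Finset E) :
    ∃ f : Fin X.card → E, Function.Injective f ∧ (∀ x, x ∈ X ↔ ∃ i, f i = x) ∧
      ∀ i j, i ≠ j → ‖f i - f (nxt i)‖ ^ 2 + ‖f j - f (nxt j)‖ ^ 2 ≤
        ‖f i - f j‖ ^ 2 + ‖f (nxt i) - f (nxt j)‖ ^ 2 := by
  set g : Fin X.card → E := fun i => X.equivFin.symm i with hg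
  have hginj : Function.Injective g := Subtype.val_injective.comp X.equivFin.symm.injective
  obtain ⟨ρ, hρ⟩ := Finite.exists_min
    (fun ρ : Equiv.Perm (Fin X.card) => ∑ l, ‖g (ρ l) - g (ρ (nxt l))‖ ^ 2)
  refine ⟨g ∘ ρ, hginj.comp ρ.injective, fun x => ⟨fun hx => ?_, ?_⟩, ?_⟩
  · exact ⟨ρ.symm (X.equivFin ⟨x, hx⟩), by simp [hg]⟩
  · rintro ⟨i, rfl⟩
    exact (X.equivFin.symm (ρ i)).2
  have main : ∀ i j, i < j → ‖g (ρ i) - g (ρ (nxt i))‖ ^ 2 + ‖g (ρ j) - g (ρ (nxt j))‖ ^ 2 ≤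
        ‖g (ρ i) - g (ρ j)‖ ^ 2 + ‖g (ρ (nxt i)) - g (ρ (nxt j))‖ ^ 2 := by
    intro i j hij
    have h1 := segRev_cost (fun a b => ‖g (ρ a) - g (ρ b)‖ ^ 2)
      (fun a b => by rw [norm_sub_rev]) hij
    have h2 := hρ ((segRev i.val (j.val + 1) j.isLt).trans ρ)
    simp only [Equiv.trans_apply] at h2
    linarith
  intro i j hij
  rcases lt_or_gt_of_ne hij with h | h
  · exact main i j h
  · have := main j i h
    simp only [Function.comp]
    rw [norm_sub_rev (g (ρ i)) (g (ρ j)), norm_sub_rev (g (ρ (nxt i))) (g (ρ (nxt j)))]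
    linarith

open scoped RealInnerProductSpace in
lemma sum_max_one_sub_le_two {E ι : Type*} [NormedAddCommGroup E] [InnerProductSpace ℝ E]
    (s : Finset ι) (m u : ι → E) (hu : ∀ i ∈ s, u i ≠ 0)
    (h : ∀ i ∈ s, ∀ j ∈ s, i ≠ j → ‖u i + u j‖ ^ 2 ≤ ‖m i - m j‖ ^ 2) (x : E) :
    ∑ i ∈ s, max 0 (1 - ‖x - m i‖ ^ 2 / ‖u i‖ ^ 2) ≤ 2 := by
  classical
  set F := s.filter (fun i => 0 ≤ 1 - ‖x - m i‖ ^ 2 / ‖u i‖ ^ 2) with hF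
  have h1 : ∑ i ∈ s, max 0 (1 - ‖x - m i‖ ^ 2 / ‖u i‖ ^ 2)
      = ∑ i ∈ F, (1 - ‖x - m i‖ ^ 2 / ‖u i‖ ^ 2) := by
    rw [hF, Finset.sum_filter]
    refine Finset.sum_congr rfl fun i _ => ?_
    split_ifs with hi
    · exact max_eq_right hi
    · exact max_eq_left (not_le.1 hi).le
  rw [h1]
  have hFs : ∀ i ∈ F, i ∈ s := fun i hi => (Finset.mem_filter.1 hi).1
  rcases F.eq_empty_or_nonempty with hemp | hne
  · simp [hemp]
  set c : ι → ℝ := fun i => (‖u i‖ ^ 2)⁻¹ with hc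
  have hcpos : ∀ i ∈ F, 0 < c i := fun i hi => by
    have := norm_pos_iff.2 (hu i (hFs i hi))
    positivity
  have hcu : ∀ i ∈ F, c i * ‖u i‖ ^ 2 = 1 := fun i hi => by
    have := norm_pos_iff.2 (hu i (hFs i hi))
    simp only [hc]; field_simp
  set C := ∑ i ∈ F, c i with hC
  have hCpos : 0 < C := Finset.sum_pos hcpos hne
  set y : ι → E := fun i => x - m i with hy
  have hsq : ∀ v : ι → E, ∑ i ∈ F, ∑ j ∈ F, c i * c j * ⟪v i, v j⟫ = ‖∑ i ∈ F, c i • v i‖ ^ 2 := by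
    intro v
    rw [← real_inner_self_eq_norm_sq, sum_inner]
    refine Finset.sum_congr rfl fun i _ => ?_
    rw [inner_sum]
    refine Finset.sum_congr rfl fun j _ => ?_
    rw [real_inner_smul_left, real_inner_smul_right]; ring
  have hdiag : ∀ v : ι → E, ∑ i ∈ F, ∑ j ∈ F, c i * c j * (‖v i‖ ^ 2 + ‖v j‖ ^ 2)
      = 2 * C * ∑ i ∈ F, c i * ‖v i‖ ^ 2 := by
    intro v
    have e1 : ∑ i ∈ F, ∑ j ∈ F, c i * c j * ‖v i‖ ^ 2 = C * ∑ i ∈ F, c i * ‖v i‖ ^ 2 := by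
      rw [hC, Finset.sum_mul_sum, Finset.sum_comm]
      exact Finset.sum_congr rfl fun i _ => Finset.sum_congr rfl fun j _ => by ring
    have e2 : ∑ i ∈ F, ∑ j ∈ F, c i * c j * ‖v j‖ ^ 2 = C * ∑ i ∈ F, c i * ‖v i‖ ^ 2 := by
      rw [hC, Finset.sum_mul_sum]
      exact Finset.sum_congr rfl fun i _ => Finset.sum_congr rfl fun j _ => by ring
    simp only [mul_add, Finset.sum_add_distrib]
    rw [e1, e2]; ring
  have hlow : -(4 * C) ≤ ∑ i ∈ F, ∑ j ∈ F, c i * c j * (‖y i - y j‖ ^ 2 - ‖u i + u j‖ ^ 2) := by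
    have : -(4 * C) = ∑ i ∈ F, ∑ j ∈ F, if i = j then -(4 * c i) else 0 := by
      rw [hC, Finset.mul_sum, ← Finset.sum_neg_distrib]
      refine Finset.sum_congr rfl fun i hi => ?_
      rw [Finset.sum_ite_eq]; simp [hi]
    rw [this]
    refine Finset.sum_le_sum fun i hi => Finset.sum_le_sum fun j hj => ?_
    split_ifs with hij
    · subst hij
      rw [sub_self, norm_zero, ← two_smul ℝ (u i), norm_smul]
      have := hcu i hi
      simp only [Real.norm_ofNat]
      have e : c i * c i * (0 ^ 2 - (2 * ‖u i‖) ^ 2) = -(4 * c i) * (c i * ‖u i‖ ^ 2) := by ring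
      rw [e, this, mul_one]
    · have e : y i - y j = m j - m i := by simp [hy]
      rw [e]
      have h2 := h j (hFs j hj) i (hFs i hi) (Ne.symm hij)
      rw [add_comm (u j)] at h2
      exact mul_nonneg (mul_pos (hcpos i hi) (hcpos j hj)).le (sub_nonneg.2 h2)
  have hexp : ∑ i ∈ F, ∑ j ∈ F, c i * c j * (‖y i - y j‖ ^ 2 - ‖u i + u j‖ ^ 2)
      = 2 * C * ∑ i ∈ F, c i * ‖y i‖ ^ 2 - 2 * C * ∑ i ∈ F, c i * ‖u i‖ ^ 2
        - 2 * ‖∑ i ∈ F, c i • y i‖ ^ 2 - 2 * ‖∑ i ∈ F, c i • u i‖ ^ 2 := by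
    rw [← hdiag, ← hdiag, ← hsq, ← hsq]
    simp only [Finset.mul_sum, ← Finset.sum_sub_distrib]
    refine Finset.sum_congr rfl fun i _ => Finset.sum_congr rfl fun j _ => ?_
    rw [norm_sub_sq_real, norm_add_sq_real]; ring
  have hfin : ∑ i ∈ F, (1 - ‖y i‖ ^ 2 / ‖u i‖ ^ 2)
      = ∑ i ∈ F, c i * ‖u i‖ ^ 2 - ∑ i ∈ F, c i * ‖y i‖ ^ 2 := by
    rw [← Finset.sum_sub_distrib]
    refine Finset.sum_congr rfl fun i hi => ?_
    rw [hcu i hi]; simp only [hc]; ring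
  rw [hfin]
  have p1 := sq_nonneg ‖∑ i ∈ F, c i • y i‖
  have p2 := sq_nonneg ‖∑ i ∈ F, c i • u i‖
  have : C * (∑ i ∈ F, c i * ‖u i‖ ^ 2 - ∑ i ∈ F, c i * ‖y i‖ ^ 2) ≤ C * 2 := by linarith
  exact le_of_mul_le_mul_left this hCpos

open MeasureTheory in
lemma lintegral_exp_neg_pow_six_le :
    ∫⁻ z in Set.Ioi (0 : ℝ), ENNReal.ofReal (Real.exp (-z ^ 6)) ≤ 1 := by
  have h1 : ∫ x in Set.Ioi (0 : ℝ), Real.exp (-x ^ 6) = Real.Gamma (1 / 6 + 1) := by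
    rw [← integral_exp_neg_rpow (by norm_num : (0 : ℝ) < 6)]
    norm_cast
  have hpos : 0 < Real.Gamma (1 / 6 + 1) := Real.Gamma_pos_of_pos (by norm_num)
  have hinteg : IntegrableOn (fun x : ℝ => Real.exp (-x ^ 6)) (Set.Ioi 0) := by
    by_contra h
    rw [integral_undef h] at h1
    exact hpos.ne h1
  have hle : Real.Gamma (1 / 6 + 1) ≤ 1 := by
    have := Real.convexOn_Gamma.2 (Set.mem_Ioi.2 one_pos) (Set.mem_Ioi.2 two_pos)
      (by norm_num : (0 : ℝ) ≤ 5 / 6) (by norm_num : (0 : ℝ) ≤ 1 / 6) (by norm_num)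
    simp only [smul_eq_mul, Real.Gamma_one, Real.Gamma_two] at this
    norm_num at this ⊢
    exact this
  rw [← ofReal_integral_eq_lintegral_ofReal hinteg (ae_of_all _ fun x => (Real.exp_pos _).le), h1]
  exact ENNReal.ofReal_le_one.2 hle

open MeasureTheory in
lemma lintegral_eq_two_mul_of_even (F : ℝ → ENNReal) (hev : ∀ x, F (-x) = F x) :
    ∫⁻ z, F z = 2 * ∫⁻ z in Set.Ioi (0 : ℝ), F z := by
  rw [← lintegral_add_compl F (measurableSet_Ioi (a := (0 : ℝ))), two_mul]
  congr 1
  rw [Set.compl_Ioi, setLIntegral_congr Iio_ae_eq_Iic.symm]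
  rw [← lintegral_indicator measurableSet_Iio, ← lintegral_indicator measurableSet_Ioi,
    ← lintegral_neg_eq_self]
  refine lintegral_congr fun x => ?_
  by_cases h : 0 < x <;> simp [Set.indicator, h, hev]

open MeasureTheory in
lemma lintegral_mul_exp_neg_pow_six_le {F : ℝ → ENNReal} (hF : Measurable F)
    (hanti : AntitoneOn F (Set.Ici 0)) :
    ∫⁻ z in Set.Ioi (0 : ℝ), F z * ENNReal.ofReal (Real.exp (-z ^ 6)) ≤
      ∫⁻ z in Set.Ioc (0 : ℝ) 1, F z := by
  set w : ℝ → ENNReal := fun z => ENNReal.ofReal (Real.exp (-z ^ 6)) with hw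
  have hwm : Measurable w := by fun_prop
  have hw1 : ∀ z, w z ≤ 1 := fun z => by
    refine ENNReal.ofReal_le_one.2 (Real.exp_le_one_iff.2 ?_)
    have : 0 ≤ z ^ 6 := by positivity
    linarith
  have hsplit : ∀ g : ℝ → ENNReal, ∫⁻ z in Set.Ioi (0 : ℝ), g z
      = (∫⁻ z in Set.Ioc (0 : ℝ) 1, g z) + ∫⁻ z in Set.Ioi (1 : ℝ), g z := fun g => by
    rw [← Set.Ioc_union_Ioi_eq_Ioi (zero_le_one' ℝ)]
    exact lintegral_union measurableSet_Ioi Set.Ioc_disjoint_Ioi_same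
  have htail : ∫⁻ z in Set.Ioi (1 : ℝ), w z ≤ ∫⁻ z in Set.Ioc (0 : ℝ) 1, (1 - w z) := by
    have h1 : (∫⁻ z in Set.Ioc (0 : ℝ) 1, w z) + ∫⁻ z in Set.Ioi (1 : ℝ), w z ≤ 1 := by
      rw [← hsplit]; exact lintegral_exp_neg_pow_six_le
    have h2 : (∫⁻ z in Set.Ioc (0 : ℝ) 1, w z) + ∫⁻ z in Set.Ioc (0 : ℝ) 1, (1 - w z) = 1 := by
      rw [← lintegral_add_left hwm]
      simp only [add_tsub_cancel_of_le (hw1 _)]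
      simp
    have h3 : (∫⁻ z in Set.Ioc (0 : ℝ) 1, w z) ≠ ⊤ :=
      ne_top_of_le_ne_top ENNReal.one_ne_top (le_trans le_self_add h1)
    exact (ENNReal.add_le_add_iff_left h3).1 (h1.trans h2.ge)
  calc ∫⁻ z in Set.Ioi (0 : ℝ), F z * w z
      = (∫⁻ z in Set.Ioc (0 : ℝ) 1, F z * w z) + ∫⁻ z in Set.Ioi (1 : ℝ), F z * w z := hsplit _
    _ ≤ (∫⁻ z in Set.Ioc (0 : ℝ) 1, F z * w z) + ∫⁻ z in Set.Ioi (1 : ℝ), F 1 * w z := by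
        refine add_le_add le_rfl (setLIntegral_mono (by fun_prop) fun z hz => ?_)
        have hz' : (1 : ℝ) < z := hz
        gcongr
        exact hanti (by simp) (by simp; linarith) hz'.le
    _ = (∫⁻ z in Set.Ioc (0 : ℝ) 1, F z * w z) + F 1 * ∫⁻ z in Set.Ioi (1 : ℝ), w z := by
        rw [lintegral_const_mul _ hwm]
    _ ≤ (∫⁻ z in Set.Ioc (0 : ℝ) 1, F z * w z) + F 1 * ∫⁻ z in Set.Ioc (0 : ℝ) 1, (1 - w z) := by
        gcongr
    _ = (∫⁻ z in Set.Ioc (0 : ℝ) 1, F z * w z) + ∫⁻ z in Set.Ioc (0 : ℝ) 1, F 1 * (1 - w z) := by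
        rw [lintegral_const_mul _ (by fun_prop)]
    _ ≤ (∫⁻ z in Set.Ioc (0 : ℝ) 1, F z * w z) + ∫⁻ z in Set.Ioc (0 : ℝ) 1, F z * (1 - w z) := by
        refine add_le_add le_rfl (setLIntegral_mono (by fun_prop) fun z hz => ?_)
        gcongr
        exact hanti hz.1.le (by simp) hz.2
    _ = ∫⁻ z in Set.Ioc (0 : ℝ) 1, F z := by
        rw [← lintegral_add_left (by fun_prop)]
        refine lintegral_congr fun z => ?_
        rw [← mul_add, add_tsub_cancel_of_le (hw1 _), mul_one]

open MeasureTheory in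
lemma lintegral_sq_le_lintegral_sub_sq {G : ℝ → ENNReal} (hG : Antitone G) {m : ℝ}
    (hm : m ∈ Set.Icc (0 : ℝ) 1) :
    ∫⁻ z in Set.Ioc (0 : ℝ) 1, G (z ^ 2) ≤ ∫⁻ x in Set.Icc (0 : ℝ) 1, G ((x - m) ^ 2) := by
  have hGm : Measurable G := hG.measurable
  have hsplit : ∀ g : ℝ → ENNReal, ∫⁻ z in Set.Ioc (0 : ℝ) 1, g z
      = (∫⁻ z in Set.Ioo (0 : ℝ) m, g z) + ∫⁻ z in Set.Ioc m 1, g z := fun g => by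
    rw [← Set.Ioc_union_Ioc_eq_Ioc hm.1 hm.2,
      lintegral_union measurableSet_Ioc (Set.Ioc_disjoint_Ioc_of_le le_rfl),
      setLIntegral_congr Ioo_ae_eq_Ioc]
  rw [setLIntegral_congr Ioc_ae_eq_Icc.symm, hsplit, hsplit]
  refine add_le_add (le_of_eq ?_) (setLIntegral_mono (by fun_prop) fun z hz => hG ?_)
  · rw [← lintegral_indicator measurableSet_Ioo, ← lintegral_indicator measurableSet_Ioo,
      ← lintegral_sub_left_eq_self _ m]
    refine lintegral_congr fun x => ?_
    have : m - x ∈ Set.Ioo 0 m ↔ x ∈ Set.Ioo 0 m := by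
      simp only [Set.mem_Ioo]; constructor <;> rintro ⟨a, b⟩ <;> constructor <;> linarith
    have e : (m - x) ^ 2 = (x - m) ^ 2 := by ring
    by_cases h : x ∈ Set.Ioo 0 m
    · rw [Set.indicator_of_mem (this.2 h), Set.indicator_of_mem h, e]
    · rw [Set.indicator_of_notMem (fun h' => h (this.1 h')), Set.indicator_of_notMem h]
  · have h1 : m < z := hz.1
    have := hm.1
    nlinarith

open MeasureTheory in
lemma lintegral_sq_mul_weight_le {G : ℝ → ENNReal} (hG : Antitone G) {m : ℝ}
    (hm : m ∈ Set.Icc (0 : ℝ) 1) :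
    ∫⁻ z : ℝ, G (z ^ 2) * ENNReal.ofReal (Real.exp (-z ^ 6) / 2) ≤
      ∫⁻ x : ℝ, G ((x - m) ^ 2) * (Set.Icc (0 : ℝ) 1).indicator 1 x := by
  have hGm : Measurable G := hG.measurable
  have hR : ∫⁻ x : ℝ, G ((x - m) ^ 2) * (Set.Icc (0 : ℝ) 1).indicator 1 x
      = ∫⁻ x in Set.Icc (0 : ℝ) 1, G ((x - m) ^ 2) := by
    rw [← lintegral_indicator measurableSet_Icc]
    refine lintegral_congr fun x => ?_
    by_cases h : x ∈ Set.Icc (0 : ℝ) 1 <;> simp [Set.indicator, h]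
  rw [hR]
  refine le_trans ?_ (lintegral_sq_le_lintegral_sub_sq hG hm)
  refine le_trans (le_of_eq ?_) (lintegral_mul_exp_neg_pow_six_le (F := fun z => G (z ^ 2))
    (by fun_prop) ?_)
  · rw [lintegral_eq_two_mul_of_even _ (fun x => by
      rw [neg_sq, (by decide : Even 6).neg_pow]), ← lintegral_const_mul _ (by fun_prop)]
    refine lintegral_congr fun z => ?_
    rw [ENNReal.ofReal_div_of_pos two_pos, mul_left_comm, ENNReal.ofReal_ofNat,
      ENNReal.mul_div_cancel (by simp) (by simp)]
  · intro a ha b hb hab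
    exact hG (pow_le_pow_left₀ ha hab 2)

open MeasureTheory in
lemma lintegral_fin_succ {n : ℕ} {F : (Fin (n + 1) → ℝ) → ENNReal} (hF : Measurable F) :
    ∫⁻ x, F x = ∫⁻ s : ℝ, ∫⁻ y : Fin n → ℝ, F (Fin.cons s y) := by
  have h := (volume_preserving_piFinSuccAbove (fun _ : Fin (n + 1) => ℝ) 0).symm
  rw [← h.lintegral_comp hF, Measure.volume_eq_prod, lintegral_prod (fun p => F
    ((MeasurableEquiv.piFinSuccAbove (fun _ => ℝ) 0).symm p))
    (hF.comp (MeasurableEquiv.measurable _)).aemeasurable]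
  refine lintegral_congr fun s => lintegral_congr fun y => ?_
  congr 1
  exact Fin.insertNth_zero' s y

open MeasureTheory in
lemma lintegral_sum_mul_prod_le {n : ℕ} {a b : Fin n → ℝ → ℝ} {v w : Fin n → ℝ → ENNReal}
    (ha : ∀ i, Measurable (a i)) (hb : ∀ i, Measurable (b i)) (hv : ∀ i, Measurable (v i))
    (hw : ∀ i, Measurable (w i))
    (h : ∀ i, ∀ G : ℝ → ENNReal, Antitone G →
      ∫⁻ z, G (b i z) * w i z ≤ ∫⁻ x, G (a i x) * v i x)
    {G : ℝ → ENNReal} (hG : Antitone G) :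
    ∫⁻ z : Fin n → ℝ, G (∑ i, b i (z i)) * ∏ i, w i (z i) ≤
      ∫⁻ x : Fin n → ℝ, G (∑ i, a i (x i)) * ∏ i, v i (x i) := by
  induction n generalizing G with
  | zero => simp
  | succ n ih =>
    have hGm : Measurable G := hG.measurable
    rw [lintegral_fin_succ (by fun_prop), lintegral_fin_succ (by fun_prop)]
    simp only [Fin.sum_univ_succ, Fin.prod_univ_succ, Fin.cons_zero, Fin.cons_succ]
    calc ∫⁻ s : ℝ, ∫⁻ y : Fin n → ℝ, G (b 0 s + ∑ i : Fin n, b i.succ (y i)) *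
            (w 0 s * ∏ i : Fin n, w i.succ (y i))
        = ∫⁻ s : ℝ, w 0 s * ∫⁻ y : Fin n → ℝ, G (b 0 s + ∑ i : Fin n, b i.succ (y i)) *
            ∏ i : Fin n, w i.succ (y i) := by
          refine lintegral_congr fun s => ?_
          rw [← lintegral_const_mul _ (by fun_prop)]
          exact lintegral_congr fun y => by ring
      _ ≤ ∫⁻ s : ℝ, w 0 s * ∫⁻ y : Fin n → ℝ, G (b 0 s + ∑ i : Fin n, a i.succ (y i)) *
            ∏ i : Fin n, v i.succ (y i) := by
          refine lintegral_mono fun s => mul_le_mul_right (ih (fun i => ha i.succ)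
            (fun i => hb i.succ) (fun i => hv i.succ) (fun i => hw i.succ)
            (fun i => h i.succ) (G := fun r => G (b 0 s + r)) ?_) _
          exact fun x y hxy => hG (by linarith)
      _ = ∫⁻ s : ℝ, ∫⁻ y : Fin n → ℝ, (G (b 0 s + ∑ i : Fin n, a i.succ (y i)) * w 0 s) *
            ∏ i : Fin n, v i.succ (y i) := by
          refine lintegral_congr fun s => ?_
          rw [← lintegral_const_mul _ (by fun_prop)]
          exact lintegral_congr fun y => by ring
      _ = ∫⁻ y : Fin n → ℝ, ∫⁻ s : ℝ, (G (b 0 s + ∑ i : Fin n, a i.succ (y i)) * w 0 s) *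
            ∏ i : Fin n, v i.succ (y i) := lintegral_lintegral_swap (by fun_prop)
      _ = ∫⁻ y : Fin n → ℝ, (∫⁻ s : ℝ, (G (b 0 s + ∑ i : Fin n, a i.succ (y i)) * w 0 s)) *
            ∏ i : Fin n, v i.succ (y i) := by
          refine lintegral_congr fun y => ?_
          rw [lintegral_mul_const _ (by fun_prop)]
      _ ≤ ∫⁻ y : Fin n → ℝ, (∫⁻ s : ℝ, (G (a 0 s + ∑ i : Fin n, a i.succ (y i)) * v 0 s)) *
            ∏ i : Fin n, v i.succ (y i) := by
          refine lintegral_mono fun y => mul_le_mul_left (h 0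
            (fun r => G (r + ∑ i : Fin n, a i.succ (y i))) ?_) _
          exact fun x y hxy => hG (by linarith)
      _ = ∫⁻ y : Fin n → ℝ, ∫⁻ s : ℝ, (G (a 0 s + ∑ i : Fin n, a i.succ (y i)) * v 0 s) *
            ∏ i : Fin n, v i.succ (y i) := by
          refine lintegral_congr fun y => ?_
          rw [lintegral_mul_const _ (by fun_prop)]
      _ = ∫⁻ s : ℝ, ∫⁻ y : Fin n → ℝ, (G (a 0 s + ∑ i : Fin n, a i.succ (y i)) * v 0 s) *
            ∏ i : Fin n, v i.succ (y i) := lintegral_lintegral_swap (by fun_prop)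
      _ = _ := by simp only [mul_assoc]

lemma hasCompactSupport_max_zero_one_sub {k : ℕ} (m : Fin k → ℝ) {R : ℝ} (hR : 0 < R) :
    HasCompactSupport (fun x : Fin k → ℝ => max 0 (1 - (∑ i, (x i - m i) ^ 2) / R)) := by
  refine HasCompactSupport.intro
    (isCompact_Icc (a := fun i => m i - Real.sqrt R) (b := fun i => m i + Real.sqrt R)) ?_
  intro x hx
  refine max_eq_left (sub_nonpos.2 ((one_le_div hR).2 ?_))
  by_contra! hlt
  refine hx ?_
  have hi : ∀ i, |x i - m i| ≤ Real.sqrt R := fun i => by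
    rw [← Real.sqrt_sq_eq_abs]
    refine Real.sqrt_le_sqrt (le_trans ?_ hlt.le)
    exact Finset.single_le_sum (f := fun i => (x i - m i) ^ 2)
      (fun j _ => sq_nonneg _) (Finset.mem_univ i)
  constructor <;> intro i <;> have := abs_le.1 (hi i) <;> simp only <;> linarith

open MeasureTheory in
lemma integral_mul_exp_neg_pow_six_le {k : ℕ} {m : Fin k → ℝ} (hm : ∀ i, m i ∈ Set.Icc (0 : ℝ) 1)
    {R : ℝ} (hR : 0 < R) :
    (1 / 2) ^ k * ∫ z : Fin k → ℝ, max 0 (1 - (∑ i, z i ^ 2) / R) * Real.exp (-∑ i, z i ^ 6) ≤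
      ∫ x in Set.Icc (0 : Fin k → ℝ) 1, max 0 (1 - (∑ i, (x i - m i) ^ 2) / R) := by
  have hG : Antitone (fun r : ℝ => ENNReal.ofReal (max 0 (1 - r / R))) := fun a b hab => by
    refine ENNReal.ofReal_le_ofReal (max_le_max le_rfl ?_)
    gcongr
  have key := lintegral_sum_mul_prod_le (n := k) (a := fun i x => (x - m i) ^ 2)
    (b := fun _ z => z ^ 2) (v := fun _ => (Set.Icc (0 : ℝ) 1).indicator 1)
    (w := fun _ z => ENNReal.ofReal (Real.exp (-z ^ 6) / 2))
    (fun i => by fun_prop) (fun i => by fun_prop)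
    (fun i => measurable_one.indicator measurableSet_Icc) (fun i => by fun_prop)
    (fun i G hG => lintegral_sq_mul_weight_le hG (hm i)) hG
  have hL : ∀ z : Fin k → ℝ, ENNReal.ofReal (max 0 (1 - (∑ i, z i ^ 2) / R)) *
      ∏ i, ENNReal.ofReal (Real.exp (-z i ^ 6) / 2) = ENNReal.ofReal ((1 / 2) ^ k *
        (max 0 (1 - (∑ i, z i ^ 2) / R) * Real.exp (-∑ i, z i ^ 6))) := by
    intro z
    rw [← ENNReal.ofReal_prod_of_nonneg (fun i _ => by positivity),
      ← ENNReal.ofReal_mul (le_max_left _ _)]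
    congr 1
    rw [Finset.prod_div_distrib, Finset.prod_const, ← Real.exp_sum, Finset.sum_neg_distrib]
    simp
    ring
  have hRt : ∀ x : Fin k → ℝ, ENNReal.ofReal (max 0 (1 - (∑ i, (x i - m i) ^ 2) / R)) *
      ∏ i, (Set.Icc (0 : ℝ) 1).indicator (1 : ℝ → ENNReal) (x i) =
      (Set.Icc (0 : Fin k → ℝ) 1).indicator
        (fun x => ENNReal.ofReal (max 0 (1 - (∑ i, (x i - m i) ^ 2) / R))) x := by
    intro x
    by_cases hx : x ∈ Set.Icc (0 : Fin k → ℝ) 1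
    · rw [Set.indicator_of_mem hx, Finset.prod_eq_one, mul_one]
      intro i _
      exact Set.indicator_of_mem (show x i ∈ Set.Icc (0 : ℝ) 1 from ⟨hx.1 i, hx.2 i⟩) _
    · rw [Set.indicator_of_notMem hx]
      have : ∃ i, x i ∉ Set.Icc (0 : ℝ) 1 := by
        by_contra! h
        exact hx ⟨fun i => (h i).1, fun i => (h i).2⟩
      obtain ⟨i, hi⟩ := this
      rw [Finset.prod_eq_zero (Finset.mem_univ i) (Set.indicator_of_notMem hi _), mul_zero]
  simp only [hL, hRt] at key
  rw [lintegral_indicator measurableSet_Icc] at key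
  have hc : Continuous (fun x : Fin k → ℝ => max 0 (1 - (∑ i, (x i - m i) ^ 2) / R)) := by
    fun_prop
  have hi1 : IntegrableOn (fun x : Fin k → ℝ => max 0 (1 - (∑ i, (x i - m i) ^ 2) / R))
      (Set.Icc 0 1) := (hc.continuousOn).integrableOn_compact isCompact_Icc
  have hcs : HasCompactSupport (fun z : Fin k → ℝ => max 0 (1 - (∑ i, z i ^ 2) / R)) := by
    simpa using hasCompactSupport_max_zero_one_sub (0 : Fin k → ℝ) hR
  have hi2 : Integrable (fun z : Fin k → ℝ => (1 / 2) ^ k *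
      (max 0 (1 - (∑ i, z i ^ 2) / R) * Real.exp (-∑ i, z i ^ 6))) := by
    refine Integrable.const_mul ?_ _
    exact Continuous.integrable_of_hasCompactSupport (by fun_prop) hcs.mul_right
  rw [← ofReal_integral_eq_lintegral_ofReal hi1 (ae_of_all _ fun x => le_max_left _ _),
    ← ofReal_integral_eq_lintegral_ofReal hi2 (ae_of_all _ fun x => by
      have := le_max_left 0 (1 - (∑ i, x i ^ 2) / R)
      positivity), integral_const_mul] at key
  exact (ENNReal.ofReal_le_ofReal_iff (integral_nonneg fun x => le_max_left _ _)).1 key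

open MeasureTheory in
lemma lintegral_max_zero_sub_mul_exp_neg {r : ℝ} (hr : 0 ≤ r) :
    ∫⁻ s in Set.Ioi (0 : ℝ), ENNReal.ofReal (max 0 (s - r) * Real.exp (-s)) =
      ENNReal.ofReal (Real.exp (-r)) := by
  have hΓ : ∫⁻ u in Set.Ioi (0 : ℝ), ENNReal.ofReal (Real.exp (-u) * u ^ ((2 : ℝ) - 1)) = 1 := by
    rw [← ofReal_integral_eq_lintegral_ofReal (Real.GammaIntegral_convergent two_pos),
      ← Real.Gamma_eq_integral two_pos, Real.Gamma_two, ENNReal.ofReal_one]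
    refine (ae_restrict_iff' measurableSet_Ioi).2 (ae_of_all _ fun u hu => ?_)
    have : (0 : ℝ) < u := hu
    simp only [Pi.zero_apply]; positivity
  rw [← lintegral_indicator measurableSet_Ioi, ← lintegral_add_right_eq_self _ r]
  calc _ = ∫⁻ u, (Set.Ioi (0 : ℝ)).indicator (fun u => ENNReal.ofReal (Real.exp (-r)) *
        ENNReal.ofReal (Real.exp (-u) * u ^ ((2 : ℝ) - 1))) u := by
        refine lintegral_congr fun u => ?_
        by_cases hu : 0 < u
        · rw [Set.indicator_of_mem (show u + r ∈ Set.Ioi (0 : ℝ) from by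
            simp only [Set.mem_Ioi]; linarith), Set.indicator_of_mem (show u ∈ Set.Ioi (0 : ℝ) from hu),
            ← ENNReal.ofReal_mul (Real.exp_pos _).le]
          congr 1
          rw [add_sub_cancel_right, max_eq_right hu.le, neg_add, Real.exp_add]
          norm_num
          ring
        · rw [Set.indicator_of_notMem (show u ∉ Set.Ioi (0 : ℝ) from hu)]
          refine Set.indicator_apply_eq_zero.2 fun _ => ?_
          rw [add_sub_cancel_right, max_eq_left (not_lt.1 hu)]
          simp
    _ = ENNReal.ofReal (Real.exp (-r)) := by
        rw [lintegral_indicator measurableSet_Ioi, lintegral_const_mul _ (by fun_prop), hΓ, mul_one]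

open MeasureTheory in
lemma integral_max_zero_sq_sub_mul {k d : ℕ} {h : (Fin k → ℝ) → ℝ}
    (hhom : ∀ r : ℝ, ∀ z, h (r • z) = r ^ d * h z) {ρ : ℝ} (hρ : 0 < ρ) :
    ∫ z, max 0 (ρ ^ 2 - ∑ i, z i ^ 2) * h z =
      ρ ^ (k + d + 2) * ∫ z, max 0 (1 - ∑ i, z i ^ 2) * h z := by
  have e := Measure.integral_comp_smul volume (fun z : Fin k → ℝ =>
    max 0 (ρ ^ 2 - ∑ i, z i ^ 2) * h z) ρ
  have e2 : ∀ x : Fin k → ℝ, max 0 (ρ ^ 2 - ∑ i, (ρ • x) i ^ 2) * h (ρ • x) =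
      ρ ^ (d + 2) * (max 0 (1 - ∑ i, x i ^ 2) * h x) := by
    intro x
    have : max 0 (ρ ^ 2 - ∑ i, (ρ • x) i ^ 2) = ρ ^ 2 * max 0 (1 - ∑ i, x i ^ 2) := by
      rw [mul_max_of_nonneg _ _ (sq_nonneg ρ), mul_zero, mul_sub, mul_one, Finset.mul_sum]
      simp only [Pi.smul_apply, smul_eq_mul, mul_pow]
    rw [this, hhom]; ring
  simp only [e2] at e
  rw [integral_const_mul, Module.finrank_fin_fun, abs_of_pos (by positivity), smul_eq_mul] at e
  have hk : ρ ^ k * (ρ ^ k)⁻¹ = 1 := mul_inv_cancel₀ (by positivity)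
  calc ∫ z, max 0 (ρ ^ 2 - ∑ i, z i ^ 2) * h z
      = ρ ^ k * ((ρ ^ k)⁻¹ * ∫ z, max 0 (ρ ^ 2 - ∑ i, z i ^ 2) * h z) := by
        rw [← mul_assoc, hk, one_mul]
    _ = _ := by rw [← e]; ring

open MeasureTheory in
lemma hasCompactSupport_max_zero_sub {k : ℕ} {s : ℝ} (hs : 0 < s) :
    HasCompactSupport (fun z : Fin k → ℝ => max 0 (s - ∑ i, z i ^ 2)) := by
  have h := (hasCompactSupport_max_zero_one_sub (0 : Fin k → ℝ) hs).mul_left (f := fun _ => s)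
  convert! h using 2 with z
  simp only [Pi.mul_apply, Pi.zero_apply, sub_zero]
  rw [mul_max_of_nonneg _ _ hs.le, mul_zero, mul_sub, mul_one, mul_div_cancel₀ _ hs.ne']

open MeasureTheory in
lemma integral_max_zero_one_sub_mul_Gamma {k d : ℕ} {h : (Fin k → ℝ) → ℝ} (hc : Continuous h)
    (h0 : ∀ z, 0 ≤ h z) (hhom : ∀ r : ℝ, ∀ z, h (r • z) = r ^ d * h z)
    (hinteg : Integrable fun z => h z * Real.exp (-∑ i, z i ^ 2)) :
    (∫ z, max 0 (1 - ∑ i, z i ^ 2) * h z) * Real.Gamma ((k + d : ℝ) / 2 + 2) =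
      ∫ z, h z * Real.exp (-∑ i, z i ^ 2) := by
  set A := ∫ z, max 0 (1 - ∑ i, z i ^ 2) * h z with hA
  have hA0 : 0 ≤ A := integral_nonneg fun z => mul_nonneg (le_max_left _ _) (h0 z)
  have hΓpos : (0 : ℝ) < (k + d : ℝ) / 2 + 2 := by positivity
  have swap : ∫⁻ s in Set.Ioi (0 : ℝ), ∫⁻ z : Fin k → ℝ,
      ENNReal.ofReal (max 0 (s - ∑ i, z i ^ 2) * h z * Real.exp (-s)) =
      ∫⁻ z : Fin k → ℝ, ∫⁻ s in Set.Ioi (0 : ℝ),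
      ENNReal.ofReal (max 0 (s - ∑ i, z i ^ 2) * h z * Real.exp (-s)) :=
    lintegral_lintegral_swap (by
      have : Measurable h := hc.measurable
      fun_prop)
  have hL : ∫⁻ s in Set.Ioi (0 : ℝ), ∫⁻ z : Fin k → ℝ,
      ENNReal.ofReal (max 0 (s - ∑ i, z i ^ 2) * h z * Real.exp (-s)) =
      ENNReal.ofReal (A * Real.Gamma ((k + d : ℝ) / 2 + 2)) := by
    calc _ = ∫⁻ s in Set.Ioi (0 : ℝ), ENNReal.ofReal A *
          ENNReal.ofReal (Real.exp (-s) * s ^ ((k + d : ℝ) / 2 + 2 - 1)) := by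
          refine setLIntegral_congr_fun measurableSet_Ioi fun s hs => ?_
          have hs : 0 < s := hs
          rw [← ofReal_integral_eq_lintegral_ofReal, integral_mul_const,
            ← ENNReal.ofReal_mul hA0]
          · congr 1
            have e := integral_max_zero_sq_sub_mul hhom (Real.sqrt_pos.2 hs)
            rw [Real.sq_sqrt hs.le] at e
            rw [e, Real.sqrt_eq_rpow, ← Real.rpow_mul_natCast hs.le]
            have : (1 / 2 * ((k + d + 2 : ℕ) : ℝ)) = (k + d : ℝ) / 2 + 2 - 1 := by
              push_cast; ring
            rw [this]; ring
          · refine Continuous.integrable_of_hasCompactSupport (by fun_prop) ?_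
            exact ((hasCompactSupport_max_zero_sub hs).mul_right).mul_right
          · exact ae_of_all _ fun z => mul_nonneg (mul_nonneg (le_max_left _ _) (h0 z))
              (Real.exp_pos _).le
      _ = _ := by
          rw [lintegral_const_mul _ (by fun_prop), ← ofReal_integral_eq_lintegral_ofReal
            (Real.GammaIntegral_convergent hΓpos), ← Real.Gamma_eq_integral hΓpos,
            ENNReal.ofReal_mul hA0]
          refine (ae_restrict_iff' measurableSet_Ioi).2 (ae_of_all _ fun u hu => ?_)
          have : (0 : ℝ) < u := hu
          simp only [Pi.zero_apply]; positivity
  have hR : ∫⁻ z : Fin k → ℝ, ∫⁻ s in Set.Ioi (0 : ℝ),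
      ENNReal.ofReal (max 0 (s - ∑ i, z i ^ 2) * h z * Real.exp (-s)) =
      ENNReal.ofReal (∫ z, h z * Real.exp (-∑ i, z i ^ 2)) := by
    rw [ofReal_integral_eq_lintegral_ofReal hinteg
      (ae_of_all _ fun z => mul_nonneg (h0 z) (Real.exp_pos _).le)]
    refine lintegral_congr fun z => ?_
    rw [ENNReal.ofReal_mul (h0 z), ← lintegral_max_zero_sub_mul_exp_neg
      (Finset.sum_nonneg fun i _ => sq_nonneg (z i)), ← lintegral_const_mul _ (by fun_prop)]
    refine lintegral_congr fun s => ?_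
    rw [← ENNReal.ofReal_mul (h0 z)]
    congr 1; ring
  rw [hL, hR] at swap
  exact (ENNReal.ofReal_eq_ofReal_iff (mul_nonneg hA0 (Real.Gamma_pos_of_pos hΓpos).le)
    (integral_nonneg fun z => mul_nonneg (h0 z) (Real.exp_pos _).le)).1 swap

open MeasureTheory in
lemma integral_pow_six_mul_exp_neg_sq :
    ∫ x : ℝ, x ^ 6 * Real.exp (-x ^ 2) = 15 / 8 * Real.sqrt Real.pi := by
  have h1 : ∫ x : ℝ, x ^ 6 * Real.exp (-x ^ 2) = ∫ x : ℝ, |x| ^ 6 * Real.exp (-|x| ^ 2) := by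
    refine integral_congr_ae (ae_of_all _ fun x => ?_)
    simp only [(by decide : Even 6).pow_abs, sq_abs]
  rw [h1, integral_comp_abs (f := fun x => x ^ 6 * Real.exp (-x ^ 2))]
  have h2 := integral_rpow_mul_exp_neg_rpow (p := 2) (q := 6) two_pos (by norm_num)
  have h3 : Real.Gamma ((6 + 1) / 2) = 15 / 8 * Real.sqrt Real.pi := by
    rw [show ((6 : ℝ) + 1) / 2 = 1 / 2 + 1 + 1 + 1 by norm_num,
      Real.Gamma_add_one (by norm_num), Real.Gamma_add_one (by norm_num),
      Real.Gamma_add_one (by norm_num), Real.Gamma_one_half_eq]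
    ring
  rw [h3] at h2
  norm_cast at h2
  rw [h2]; ring

open MeasureTheory in
lemma integrable_pow_six_mul_exp_neg_sq : Integrable fun x : ℝ => x ^ 6 * Real.exp (-x ^ 2) := by
  by_contra h
  have h1 := integral_pow_six_mul_exp_neg_sq
  rw [integral_undef h] at h1
  have := Real.sqrt_pos.2 Real.pi_pos
  linarith

open MeasureTheory in
lemma integral_max_zero_one_sub_sq {k : ℕ} :
    ∫ z : Fin k → ℝ, max 0 (1 - ∑ i, z i ^ 2) =
      Real.sqrt Real.pi ^ k / Real.Gamma ((k : ℝ) / 2 + 2) := by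
  have hg : Integrable fun x : ℝ => Real.exp (-x ^ 2) := by
    simpa using integrable_exp_neg_mul_sq one_pos
  have hg' : ∫ x : ℝ, Real.exp (-x ^ 2) = Real.sqrt Real.pi := by
    simpa using integral_gaussian 1
  have e : ∀ z : Fin k → ℝ, 1 * Real.exp (-∑ i, z i ^ 2) = ∏ i, Real.exp (-z i ^ 2) := fun z => by
    rw [one_mul, ← Real.exp_sum, Finset.sum_neg_distrib]
  have key := integral_max_zero_one_sub_mul_Gamma (k := k) (d := 0) (h := fun _ => 1)
    continuous_const (fun _ => zero_le_one) (fun r z => by simp) (by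
      simp only [e]
      exact Integrable.fintype_prod fun _ => hg)
  simp only [e] at key
  rw [integral_fintype_prod_volume_eq_pow (fun x : ℝ => Real.exp (-x ^ 2)), hg'] at key
  simp only [mul_one, CharP.cast_eq_zero, add_zero, Fintype.card_fin] at key
  rw [eq_div_iff (Real.Gamma_pos_of_pos (by positivity)).ne', key]

open MeasureTheory in
lemma integral_max_zero_one_sub_sq_mul_pow_six {k : ℕ} (j : Fin k) :
    ∫ z : Fin k → ℝ, max 0 (1 - ∑ i, z i ^ 2) * z j ^ 6 =
      15 / 8 * Real.sqrt Real.pi ^ k / Real.Gamma ((k : ℝ) / 2 + 5) := by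
  have hg : Integrable fun x : ℝ => Real.exp (-x ^ 2) := by
    simpa using integrable_exp_neg_mul_sq one_pos
  have hg' : ∫ x : ℝ, Real.exp (-x ^ 2) = Real.sqrt Real.pi := by
    simpa using integral_gaussian 1
  set φ : Fin k → ℝ → ℝ := fun i x => (if i = j then x ^ 6 else 1) * Real.exp (-x ^ 2) with hφ
  have e : ∀ z : Fin k → ℝ, z j ^ 6 * Real.exp (-∑ i, z i ^ 2) = ∏ i, φ i (z i) := fun z => by
    simp only [hφ]
    rw [Finset.prod_mul_distrib, ← Real.exp_sum, Finset.sum_neg_distrib]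
    simp
  have hφi : ∀ i, Integrable (φ i) := fun i => by
    by_cases h : i = j
    · simpa [hφ, h] using integrable_pow_six_mul_exp_neg_sq
    · simpa [hφ, h] using hg
  have hφ' : ∀ i, ∫ x, φ i x = (if i = j then 15 / 8 else 1) * Real.sqrt Real.pi := fun i => by
    by_cases h : i = j
    · simpa [hφ, h] using integral_pow_six_mul_exp_neg_sq
    · simpa [hφ, h] using hg'
  have key := integral_max_zero_one_sub_mul_Gamma (k := k) (d := 6) (h := fun z => z j ^ 6)
    (by fun_prop) (fun _ => by positivity) (fun r z => by simp [mul_pow]) (by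
      simp only [e]
      exact Integrable.fintype_prod hφi)
  simp only [e] at key
  rw [integral_fintype_prod_volume_eq_prod φ, Finset.prod_congr rfl fun i _ => hφ' i,
    Finset.prod_mul_distrib] at key
  simp only [Finset.prod_ite_eq', Finset.mem_univ, if_true, Finset.prod_const, Finset.card_univ,
    Fintype.card_fin] at key
  rw [eq_div_iff (Real.Gamma_pos_of_pos (by positivity)).ne', ← key]
  congr 2
  push_cast; ring

open MeasureTheory in
lemma clipped_ball_integral_ge {k : ℕ} {m : Fin k → ℝ} (hm : ∀ i, m i ∈ Set.Icc (0 : ℝ) 1)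
    {ρ : ℝ} (hρ : 0 < ρ) :
    (1 / 2) ^ k * (Real.exp (-(15 * k * ρ ^ 6 / ((k + 4) * (k + 6) * (k + 8)))) *
        (ρ ^ k * Real.sqrt Real.pi ^ k / Real.Gamma ((k : ℝ) / 2 + 2))) ≤
      ∫ x in Set.Icc (0 : Fin k → ℝ) 1, max 0 (1 - (∑ i, (x i - m i) ^ 2) / ρ ^ 2) := by
  have hρ2 : 0 < ρ ^ 2 := by positivity
  refine le_trans ?_ (integral_mul_exp_neg_pow_six_le hm hρ2)
  refine mul_le_mul_of_nonneg_left ?_ (by positivity)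
  set c : ℝ := 15 * k * ρ ^ 6 / ((k + 4) * (k + 6) * (k + 8)) with hc
  set Γ2 := Real.Gamma ((k : ℝ) / 2 + 2) with hΓ2
  have hΓ2pos : 0 < Γ2 := Real.Gamma_pos_of_pos (by positivity)
  have hΓ5 : Real.Gamma ((k : ℝ) / 2 + 5) = (k + 4) * (k + 6) * (k + 8) / 8 * Γ2 := by
    rw [show (k : ℝ) / 2 + 5 = k / 2 + 2 + 1 + 1 + 1 by ring, Real.Gamma_add_one (by positivity),
      Real.Gamma_add_one (by positivity), Real.Gamma_add_one (by positivity)]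
    ring
  have hdiv : ∀ z : Fin k → ℝ, max 0 (1 - (∑ i, z i ^ 2) / ρ ^ 2) =
      (ρ ^ 2)⁻¹ * max 0 (ρ ^ 2 - ∑ i, z i ^ 2) := fun z => by
    rw [mul_max_of_nonneg _ _ (by positivity), mul_zero, mul_sub, inv_mul_cancel₀ hρ2.ne']
    congr 2; ring
  have I0 : ∫ z : Fin k → ℝ, max 0 (1 - (∑ i, z i ^ 2) / ρ ^ 2) =
      ρ ^ k * Real.sqrt Real.pi ^ k / Γ2 := by
    have e := integral_max_zero_sq_sub_mul (k := k) (d := 0) (h := fun _ => 1)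
      (fun r z => by simp) hρ
    simp only [mul_one] at e
    simp only [hdiv]
    rw [integral_const_mul, e, integral_max_zero_one_sub_sq, ← hΓ2]
    field_simp
    ring
  have I6 : ∀ j : Fin k, ∫ z : Fin k → ℝ, max 0 (1 - (∑ i, z i ^ 2) / ρ ^ 2) * z j ^ 6 =
      15 * ρ ^ 6 / ((k + 4) * (k + 6) * (k + 8)) * (ρ ^ k * Real.sqrt Real.pi ^ k / Γ2) := by
    intro j
    have e := integral_max_zero_sq_sub_mul (k := k) (d := 6) (h := fun z => z j ^ 6)
      (fun r z => by simp [mul_pow]) hρ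
    simp only [hdiv, mul_assoc]
    rw [integral_const_mul, e, integral_max_zero_one_sub_sq_mul_pow_six, hΓ5]
    field_simp
    ring
  have hcs : HasCompactSupport (fun z : Fin k → ℝ => max 0 (1 - (∑ i, z i ^ 2) / ρ ^ 2)) := by
    simpa using hasCompactSupport_max_zero_one_sub (0 : Fin k → ℝ) hρ2
  have hinteg : ∀ g : (Fin k → ℝ) → ℝ, Continuous g →
      Integrable fun z => max 0 (1 - (∑ i, z i ^ 2) / ρ ^ 2) * g z := fun g hg =>
    Continuous.integrable_of_hasCompactSupport (by fun_prop) hcs.mul_right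
  calc Real.exp (-c) * (ρ ^ k * Real.sqrt Real.pi ^ k / Γ2)
      = Real.exp (-c) * ((1 + c) * (∫ z : Fin k → ℝ, max 0 (1 - (∑ i, z i ^ 2) / ρ ^ 2)) -
          ∑ j, ∫ z : Fin k → ℝ, max 0 (1 - (∑ i, z i ^ 2) / ρ ^ 2) * z j ^ 6) := by
        simp only [I6, I0]
        rw [Finset.sum_const, Finset.card_univ, Fintype.card_fin, nsmul_eq_mul, hc]
        ring
    _ = ∫ z : Fin k → ℝ, max 0 (1 - (∑ i, z i ^ 2) / ρ ^ 2) *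
          (Real.exp (-c) * (1 + c - ∑ j, z j ^ 6)) := by
        rw [← integral_finsetSum _ fun j _ => hinteg _ (by fun_prop), ← integral_const_mul,
          ← integral_sub (by simpa [mul_comm] using hinteg (fun _ => 1 + c) (by fun_prop))
          (integrable_finsetSum _ fun j _ => hinteg _ (by fun_prop)), ← integral_const_mul]
        refine integral_congr_ae (ae_of_all _ fun z => ?_)
        simp only [← Finset.mul_sum]
        ring
    _ ≤ ∫ z : Fin k → ℝ, max 0 (1 - (∑ i, z i ^ 2) / ρ ^ 2) * Real.exp (-∑ i, z i ^ 6) := by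
        refine integral_mono (hinteg _ (by fun_prop)) (hinteg _ (by fun_prop)) fun z => ?_
        refine mul_le_mul_of_nonneg_left ?_ (le_max_left _ _)
        have h1 : Real.exp (-∑ i, z i ^ 6) = Real.exp (-c) * Real.exp (c - ∑ i, z i ^ 6) := by
          rw [← Real.exp_add]; congr 1; ring
        rw [h1]
        have := Real.add_one_le_exp (c - ∑ i, z i ^ 6)
        exact mul_le_mul_of_nonneg_left (by linarith) (Real.exp_pos _).le

open MeasureTheory in
lemma setIntegral_Icc_comp_eval {k : ℕ} (j : Fin k) {g : ℝ → ℝ} (hg : Continuous g) :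
    ∫ y in Set.Icc (0 : Fin k → ℝ) 1, g (y j) = ∫ x in Set.Icc (0 : ℝ) 1, g x := by
  have : IsProbabilityMeasure (volume.restrict (Set.Icc (0 : ℝ) 1)) :=
    ⟨by simp⟩
  have h := measurePreserving_eval (fun _ : Fin k => volume.restrict (Set.Icc (0 : ℝ) 1)) j
  have e : (volume : Measure (Fin k → ℝ)).restrict (Set.Icc 0 1) =
      Measure.pi fun _ : Fin k => volume.restrict (Set.Icc (0 : ℝ) 1) := by
    rw [← Measure.restrict_pi_pi, ← volume_pi, ← Set.pi_univ_Icc]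
    rfl
  have h2 := integral_map (μ := Measure.pi fun _ : Fin k => volume.restrict
    (Set.Icc (0 : ℝ) 1)) h.measurable.aemeasurable (f := g) hg.aestronglyMeasurable
  rw [h.map_eq] at h2
  rw [e, h2]

open MeasureTheory in
lemma volume_real_Icc_zero_one (k : ℕ) :
    (volume : Measure (Fin k → ℝ)).real (Set.Icc 0 1) = 1 := by
  simp [Measure.real, Real.volume_Icc_pi]

open MeasureTheory in
lemma setIntegral_Icc_sum_sub_sq {k : ℕ} (m : Fin k → ℝ) :
    ∫ y in Set.Icc (0 : Fin k → ℝ) 1, ∑ i, (y i - m i) ^ 2 =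
      ∑ i, (1 / 3 - m i + m i ^ 2) := by
  rw [integral_finsetSum _ fun i _ =>
    (Continuous.continuousOn (by fun_prop)).integrableOn_compact isCompact_Icc]
  refine Finset.sum_congr rfl fun i _ => ?_
  rw [setIntegral_Icc_comp_eval i (g := fun x => (x - m i) ^ 2) (by fun_prop),
    integral_Icc_eq_integral_Ioc, ← intervalIntegral.integral_of_le zero_le_one,
    intervalIntegral.integral_comp_sub_right (fun x => x ^ 2), integral_pow]
  norm_num
  ring

open MeasureTheory in
lemma shrunken_cube_integral_le {k : ℕ} {m : Fin k → ℝ} (hm : ∀ i, m i ∈ Set.Icc (0 : ℝ) 1)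
    {R θ : ℝ} (hθ0 : 0 < θ) (hθ1 : θ ≤ 1) :
    θ ^ k * (1 - θ ^ 2 / R * ∑ i, (1 / 3 - m i + m i ^ 2)) ≤
      ∫ x in Set.Icc (0 : Fin k → ℝ) 1, max 0 (1 - (∑ i, (x i - m i) ^ 2) / R) := by
  set φ : (Fin k → ℝ) → ℝ := fun x => max 0 (1 - (∑ i, (x i - m i) ^ 2) / R) with hφ
  have hφc : Continuous φ := by fun_prop
  set C := Set.Icc (0 : Fin k → ℝ) 1 with hC
  set ψ : (Fin k → ℝ) → ℝ := fun v => C.indicator φ (m + v) with hψ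
  have hψint : Integrable ψ := by
    refine Integrable.comp_add_left ?_ m
    rw [integrable_indicator_iff measurableSet_Icc]
    exact hφc.continuousOn.integrableOn_compact isCompact_Icc
  have h1 : ∫ x in C, φ x = ∫ v, ψ v := by
    rw [← integral_indicator measurableSet_Icc, ← integral_add_left_eq_self _ m]
  have h2 : ∫ v, ψ v = θ ^ k * ∫ y, ψ (θ • (y - m)) := by
    rw [integral_sub_right_eq_self (fun v => ψ (θ • v)) m, Measure.integral_comp_smul,
      Module.finrank_fin_fun, abs_of_pos (by positivity), smul_eq_mul, ← mul_assoc,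
      mul_inv_cancel₀ (by positivity), one_mul]
  have hqi : IntegrableOn (fun y : Fin k → ℝ => 1 - θ ^ 2 / R * ∑ i, (y i - m i) ^ 2) C :=
    (Continuous.continuousOn (by fun_prop)).integrableOn_compact isCompact_Icc
  have h3 : ∫ y in C, (1 - θ ^ 2 / R * ∑ i, (y i - m i) ^ 2) =
      1 - θ ^ 2 / R * ∑ i, (1 / 3 - m i + m i ^ 2) := by
    rw [integral_sub ((Continuous.continuousOn (by fun_prop)).integrableOn_compact isCompact_Icc)
      ((Continuous.continuousOn (by fun_prop)).integrableOn_compact isCompact_Icc),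
      integral_const_mul, setIntegral_Icc_sum_sub_sq]
    simp [volume_real_Icc_zero_one]
  rw [h1, h2]
  refine mul_le_mul_of_nonneg_left ?_ (by positivity)
  rw [← h3, ← integral_indicator measurableSet_Icc]
  refine integral_mono ((integrable_indicator_iff measurableSet_Icc).2 hqi)
    ((hψint.comp_smul hθ0.ne').comp_sub_right m) fun y => ?_
  by_cases hy : y ∈ C
  · have hmem : m + θ • (y - m) ∈ C := by
      refine ⟨fun i => ?_, fun i => ?_⟩ <;>
      · have a := hy.1 i
        have b := hy.2 i
        have c := hm i
        simp only [Pi.zero_apply, Pi.one_apply, Pi.add_apply, Pi.smul_apply, Pi.sub_apply,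
          smul_eq_mul, Set.mem_Icc] at *
        nlinarith
    rw [Set.indicator_of_mem hy]
    simp only [hψ]
    rw [Set.indicator_of_mem hmem]
    refine le_trans (le_of_eq ?_) (le_max_right _ _)
    simp only [Pi.add_apply, Pi.smul_apply, Pi.sub_apply, smul_eq_mul, add_sub_cancel_left,
      mul_pow, ← Finset.mul_sum]
    ring
  · rw [Set.indicator_of_notMem hy]
    exact Set.indicator_nonneg (fun x _ => le_max_left _ _) _

lemma exp_mul_one_sub_half_sq_le {c : ℝ} (hc : c ≤ 2) : Real.exp c * (1 - c / 2) ^ 2 ≤ 1 := by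
  have h1 : 1 - c / 2 ≤ Real.exp (-(c / 2)) := by
    have := Real.add_one_le_exp (-(c / 2)); linarith
  have h2 := pow_le_pow_left₀ (by linarith) h1 2
  have h3 : Real.exp (-(c / 2)) ^ 2 = Real.exp (-c) := by
    rw [← Real.exp_nat_mul]; congr 1; push_cast; ring
  calc Real.exp c * (1 - c / 2) ^ 2 ≤ Real.exp c * Real.exp (-c) := by
        rw [← h3]; exact mul_le_mul_of_nonneg_left h2 (Real.exp_pos _).le
    _ = 1 := by rw [← Real.exp_add, add_neg_cancel, Real.exp_zero]

lemma le_of_le_one_sub_half_sq_mul {A B c : ℝ} (hA : 0 ≤ B) (hc : c ≤ 2)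
    (h : A ≤ (1 - c / 2) ^ 2 * B) : A * Real.exp c ≤ B := by
  calc A * Real.exp c ≤ ((1 - c / 2) ^ 2 * B) * Real.exp c :=
        mul_le_mul_of_nonneg_right h (Real.exp_pos _).le
    _ = (Real.exp c * (1 - c / 2) ^ 2) * B := by ring
    _ ≤ 1 * B := mul_le_mul_of_nonneg_right (exp_mul_one_sub_half_sq_le hc) hA
    _ = B := one_mul B

lemma sqrt_mul_sqrt_pow_even (n : ℕ) {x y : ℝ} (hx : 0 ≤ x) (hy : 0 ≤ y) :
    (Real.sqrt x * Real.sqrt y) ^ (2 * n) = (x * y) ^ n := by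
  rw [pow_mul, mul_pow, Real.sq_sqrt hx, Real.sq_sqrt hy]

lemma Gamma_mul_exp_le_of_even {n : ℕ} {c : ℝ} (hc : c ≤ 2)
    (h : ((n + 1).factorial : ℝ) * 16 ^ n ≤
      (1 - c / 2) ^ 2 * (2.718 * (2 * n) * (3.1415 * (2 * n)) ^ n)) :
    Real.Gamma (((2 * n : ℕ) : ℝ) / 2 + 2) * 4 ^ (2 * n) * Real.exp c ≤
      Real.exp 1 * ((2 * n : ℕ) : ℝ) *
        (Real.sqrt Real.pi * Real.sqrt ((2 * n : ℕ) : ℝ)) ^ (2 * n) := by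
  have e1 : Real.Gamma (((2 * n : ℕ) : ℝ) / 2 + 2) = ((n + 1).factorial : ℝ) := by
    rw [← Real.Gamma_nat_eq_factorial]; congr 1; push_cast; ring
  have e2 : (4 : ℝ) ^ (2 * n) = 16 ^ n := by rw [pow_mul]; norm_num
  rw [e1, e2, sqrt_mul_sqrt_pow_even n Real.pi_pos.le (Nat.cast_nonneg _)]
  refine le_of_le_one_sub_half_sq_mul (by positivity) hc (h.trans ?_)
  refine mul_le_mul_of_nonneg_left ?_ (sq_nonneg _)
  push_cast
  have hπ := Real.pi_gt_d4
  have he := Real.exp_one_gt_d9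
  have he' : (2.718 : ℝ) ≤ Real.exp 1 := by linarith
  gcongr

lemma Gamma_mul_exp_le_of_odd {n : ℕ} {c K : ℝ} (hc : c ≤ 2) (hK : 0 ≤ K)
    (h : (((2 * n + 3).doubleFactorial : ℝ) / 2 ^ (n + 2) * 4 ^ (2 * n + 1)) ^ 2 ≤
      ((1 - c / 2) ^ 2 * (K * (3.1415 * (2 * n + 1)) ^ n)) ^ 2 * (2 * n + 1)) :
    Real.Gamma (((2 * n + 1 : ℕ) : ℝ) / 2 + 2) * 4 ^ (2 * n + 1) * Real.exp c ≤
      K * (Real.sqrt Real.pi * Real.sqrt ((2 * n + 1 : ℕ) : ℝ)) ^ (2 * n + 1) := by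
  have e1 : Real.Gamma (((2 * n + 1 : ℕ) : ℝ) / 2 + 2) =
      ((2 * n + 3).doubleFactorial : ℝ) * Real.sqrt Real.pi / 2 ^ (n + 2) := by
    have := Real.Gamma_nat_add_one_add_half (n + 1)
    rw [show 2 * (n + 1) + 1 = 2 * n + 3 by ring, show n + 1 + 1 = n + 2 by ring] at this
    rw [← this]; congr 1; push_cast; ring
  set q : ℝ := ((2 * n + 1 : ℕ) : ℝ) with hq
  have hq' : q = 2 * n + 1 := by rw [hq]; push_cast; ring
  have hq0 : 0 ≤ q := Nat.cast_nonneg _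
  rw [e1, pow_succ (Real.sqrt Real.pi * Real.sqrt q),
    sqrt_mul_sqrt_pow_even n Real.pi_pos.le hq0]
  refine le_of_le_one_sub_half_sq_mul (by positivity) hc ?_
  have h2 : ((2 * n + 3).doubleFactorial : ℝ) / 2 ^ (n + 2) * 4 ^ (2 * n + 1) ≤
      (1 - c / 2) ^ 2 * (K * (3.1415 * (2 * n + 1)) ^ n) * Real.sqrt q := by
    refine (sq_le_sq₀ (by positivity) (by positivity)).1 ?_
    rw [mul_pow _ (Real.sqrt q), Real.sq_sqrt hq0, hq']
    exact h
  have hπ := Real.pi_gt_d4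
  have h3 : (3.1415 * (2 * n + 1) : ℝ) ^ n ≤ (Real.pi * q) ^ n := by
    rw [hq']; gcongr
  calc _ = ((2 * n + 3).doubleFactorial : ℝ) / 2 ^ (n + 2) * 4 ^ (2 * n + 1) *
        Real.sqrt Real.pi := by ring
    _ ≤ (1 - c / 2) ^ 2 * (K * (Real.pi * q) ^ n) * Real.sqrt q * Real.sqrt Real.pi := by
        refine mul_le_mul_of_nonneg_right (h2.trans ?_) (Real.sqrt_nonneg _)
        gcongr
    _ = _ := by ring

lemma Gamma_mul_exp_le_of_le {k : ℕ} (h2 : 2 ≤ k) (h23 : k ≤ 23) :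
    Real.Gamma ((k : ℝ) / 2 + 2) * 4 ^ k *
        Real.exp (15 * (k : ℝ) ^ 4 / (1728 * ((k + 4) * (k + 6) * (k + 8)))) ≤
      Real.exp 1 * k * (Real.sqrt Real.pi * Real.sqrt k) ^ k := by
  rcases Nat.even_or_odd' k with ⟨n, rfl | rfl⟩
  · refine Gamma_mul_exp_le_of_even ?_ ?_
    · rw [div_le_iff₀ (by positivity)]
      have hn : 1 ≤ n := by omega
      have hn' : n ≤ 11 := by omega
      interval_cases n <;> norm_num
    · have hn : 1 ≤ n := by omega
      have hn' : n ≤ 11 := by omega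
      interval_cases n <;> norm_num [Nat.factorial]
  · have he := Real.exp_one_gt_d9
    have hn : 1 ≤ n := by omega
    have hn' : n ≤ 11 := by omega
    refine le_trans (Gamma_mul_exp_le_of_odd (K := 2.718 * (2 * n + 1)) ?_ (by positivity) ?_) ?_
    · rw [div_le_iff₀ (by positivity)]
      interval_cases n <;> norm_num
    · interval_cases n <;> norm_num [Nat.doubleFactorial]
    · refine mul_le_mul_of_nonneg_right ?_ (by positivity)
      push_cast
      gcongr
      linarith

lemma exp_mul_sqrt_pow_le {k : ℕ} (hk : 0 < k) :
    Real.exp ((k : ℝ) / (k + 1)) * Real.sqrt k ^ k ≤ Real.sqrt ((k + 2 : ℕ) : ℝ) ^ k := by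
  have hk0 : (0 : ℝ) < k := by exact_mod_cast hk
  have h1 := Real.le_log_one_add_of_nonneg (x := 2 / (k : ℝ)) (by positivity)
  have h2 : (2 : ℝ) / (k + 1) ≤ Real.log (1 + 2 / k) := by
    refine le_trans (le_of_eq ?_) h1
    field_simp
    ring
  have h3 : Real.exp (1 / (k + 1 : ℝ)) ≤ Real.sqrt (1 + 2 / k) := by
    refine Real.le_sqrt_of_sq_le ?_
    rw [← Real.exp_nat_mul, ← Real.le_log_iff_exp_le (by positivity)]
    refine le_trans (le_of_eq ?_) h2
    push_cast; ring
  have h4 : Real.exp ((k : ℝ) / (k + 1)) = Real.exp (1 / (k + 1 : ℝ)) ^ k := by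
    rw [← Real.exp_nat_mul]; congr 1; ring
  rw [h4, ← mul_pow]
  refine pow_le_pow_left₀ (by positivity) ?_ k
  calc _ ≤ Real.sqrt (1 + 2 / k) * Real.sqrt k :=
        mul_le_mul_of_nonneg_right h3 (Real.sqrt_nonneg _)
    _ = _ := by
        rw [← Real.sqrt_mul (by positivity)]
        congr 1; push_cast; field_simp

lemma Gamma_mul_exp_linear_le {k : ℕ} (hk : 24 ≤ k) :
    Real.Gamma ((k : ℝ) / 2 + 2) * 4 ^ k * Real.exp (15 * (k : ℝ) / 1728) ≤
      Real.exp 1 * k * (Real.sqrt Real.pi * Real.sqrt k) ^ k := by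
  induction k using Nat.strong_induction_on with
  | _ k ih =>
  rcases Nat.lt_or_ge k 26 with h | h
  · obtain rfl | rfl : k = 2 * 12 ∨ k = 2 * 12 + 1 := by omega
    · refine Gamma_mul_exp_le_of_even (n := 12) ?_ ?_ <;> norm_num [Nat.factorial]
    · refine le_trans (Gamma_mul_exp_le_of_odd (n := 12) (K := 2.718 * 25) ?_ ?_ ?_) ?_
      · norm_num
      · norm_num
      · norm_num [Nat.doubleFactorial]
      · have he := Real.exp_one_gt_d9
        refine mul_le_mul_of_nonneg_right ?_ (by positivity)
        push_cast
        linarith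
  · obtain ⟨j, rfl⟩ : ∃ j, k = j + 2 := ⟨k - 2, by omega⟩
    have hj : 24 ≤ j := by omega
    have ih := ih j (by omega) hj
    have hj' : (24 : ℝ) ≤ j := by exact_mod_cast hj
    have hΓ : Real.Gamma (((j + 2 : ℕ) : ℝ) / 2 + 2) =
        ((j : ℝ) / 2 + 2) * Real.Gamma ((j : ℝ) / 2 + 2) := by
      rw [← Real.Gamma_add_one (by positivity)]; congr 1; push_cast; ring
    have hexp : Real.exp (15 * ((j + 2 : ℕ) : ℝ) / 1728) =
        Real.exp (15 * (j : ℝ) / 1728) * Real.exp (30 / 1728) := by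
      rw [← Real.exp_add]; congr 1; push_cast; ring
    have hs := exp_mul_sqrt_pow_le (k := j) (by omega)
    have hstep : 8 * (j + 4) * j * Real.exp (30 / 1728) ≤
        Real.pi * (j + 2) ^ 2 * Real.exp ((j : ℝ) / (j + 1)) := by
      have h1 : 8 * Real.exp (30 / 1728) ≤ Real.pi * Real.exp ((j : ℝ) / (j + 1)) := by
        have e : Real.exp ((j : ℝ) / (j + 1)) = Real.exp 1 *
            Real.exp (-(1 / (j + 1) + 30 / 1728)) * Real.exp (30 / 1728) := by
          rw [← Real.exp_add, ← Real.exp_add]; congr 1; field_simp; ring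
        rw [e, ← mul_assoc]
        refine mul_le_mul_of_nonneg_right ?_ (Real.exp_pos _).le
        have a1 := Real.add_one_le_exp (-(1 / ((j : ℝ) + 1) + 30 / 1728))
        have a2 : 1 / ((j : ℝ) + 1) ≤ 1 / 25 := by
          refine one_div_le_one_div_of_le (by norm_num) (by linarith)
        have a3 : (0.942 : ℝ) ≤ Real.exp (-(1 / ((j : ℝ) + 1) + 30 / 1728)) := by linarith
        have a4 := Real.exp_one_gt_d9
        have a5 := Real.pi_gt_d4
        calc (8 : ℝ) ≤ 3.1415 * (2.718 * 0.942) := by norm_num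
          _ ≤ Real.pi * (Real.exp 1 * Real.exp (-(1 / ((j : ℝ) + 1) + 30 / 1728))) := by
            gcongr
            linarith
      calc 8 * ((j : ℝ) + 4) * j * Real.exp (30 / 1728)
          = ((j + 4) * j) * (8 * Real.exp (30 / 1728)) := by ring
        _ ≤ (j + 2) ^ 2 * (Real.pi * Real.exp ((j : ℝ) / (j + 1))) :=
            mul_le_mul (by nlinarith) h1 (by positivity) (by positivity)
        _ = _ := by ring
    rw [hΓ, hexp]
    have hpow : (Real.sqrt Real.pi * Real.sqrt ((j + 2 : ℕ) : ℝ)) ^ (j + 2) =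
        Real.pi * (j + 2) * Real.sqrt Real.pi ^ j * Real.sqrt ((j + 2 : ℕ) : ℝ) ^ j := by
      rw [pow_add, mul_pow _ _ 2, Real.sq_sqrt Real.pi_pos.le, Real.sq_sqrt (Nat.cast_nonneg _),
        mul_pow]
      push_cast; ring
    rw [hpow]
    have hjpos : (0 : ℝ) < j := by linarith
    refine le_of_mul_le_mul_left ?_ hjpos
    calc (j : ℝ) * (((j : ℝ) / 2 + 2) * Real.Gamma ((j : ℝ) / 2 + 2) * 4 ^ (j + 2) *
          (Real.exp (15 * (j : ℝ) / 1728) * Real.exp (30 / 1728)))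
        = (8 * (j + 4) * j * Real.exp (30 / 1728)) *
          (Real.Gamma ((j : ℝ) / 2 + 2) * 4 ^ j * Real.exp (15 * (j : ℝ) / 1728)) := by ring
      _ ≤ (Real.pi * (j + 2) ^ 2 * Real.exp ((j : ℝ) / (j + 1))) *
          (Real.exp 1 * j * (Real.sqrt Real.pi * Real.sqrt j) ^ j) :=
          mul_le_mul hstep ih (mul_nonneg (mul_nonneg (Real.Gamma_pos_of_pos (by positivity)).le
            (by positivity)) (Real.exp_pos _).le) (by positivity)
      _ = (j * (Real.pi * (j + 2) ^ 2 * Real.exp 1 * Real.sqrt Real.pi ^ j)) *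
          (Real.exp ((j : ℝ) / (j + 1)) * Real.sqrt j ^ j) := by rw [mul_pow]; ring
      _ ≤ (j * (Real.pi * (j + 2) ^ 2 * Real.exp 1 * Real.sqrt Real.pi ^ j)) *
          Real.sqrt ((j + 2 : ℕ) : ℝ) ^ j := mul_le_mul_of_nonneg_left hs (by positivity)
      _ = _ := by push_cast; ring

lemma Gamma_mul_exp_le {k : ℕ} (hk : 2 ≤ k) :
    Real.Gamma ((k : ℝ) / 2 + 2) * 4 ^ k *
        Real.exp (15 * (k : ℝ) ^ 4 / (1728 * ((k + 4) * (k + 6) * (k + 8)))) ≤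
      Real.exp 1 * k * (Real.sqrt Real.pi * Real.sqrt k) ^ k := by
  rcases Nat.lt_or_ge k 24 with h | h
  · exact Gamma_mul_exp_le_of_le hk (by omega)
  · refine le_trans (mul_le_mul_of_nonneg_left (Real.exp_le_exp.2 ?_)
      (mul_nonneg (Real.Gamma_pos_of_pos (by positivity)).le (by positivity)))
      (Gamma_mul_exp_linear_le h)
    rw [div_le_div_iff₀ (by positivity) (by norm_num)]
    have h3 : (k : ℝ) ^ 3 ≤ (k + 4) * (k + 6) * (k + 8) := by
      have : (0 : ℝ) ≤ k := Nat.cast_nonneg k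
      nlinarith [mul_nonneg this this]
    have h0 : (0 : ℝ) ≤ 15 * k * 1728 := by positivity
    nlinarith [mul_le_mul_of_nonneg_left h3 h0]

open MeasureTheory in
lemma two_mul_pow_le_of_short {k : ℕ} {m : Fin k → ℝ} (hm : ∀ i, m i ∈ Set.Icc (0 : ℝ) 1)
    {ρ K : ℝ} (hρ : 0 < ρ) (hshort : 12 * ρ ^ 2 ≤ k)
    (hK : Real.Gamma ((k : ℝ) / 2 + 2) * 4 ^ k *
        Real.exp (15 * (k : ℝ) ^ 4 / (1728 * ((k + 4) * (k + 6) * (k + 8)))) ≤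
      K * (Real.sqrt Real.pi * Real.sqrt k) ^ k) (hK0 : 0 ≤ K) :
    (2 * ρ) ^ k ≤ K * Real.sqrt k ^ k *
      ∫ x in Set.Icc (0 : Fin k → ℝ) 1, max 0 (1 - (∑ i, (x i - m i) ^ 2) / ρ ^ 2) := by
  set Γ2 := Real.Gamma ((k : ℝ) / 2 + 2) with hΓ2
  have hΓ2pos : 0 < Γ2 := Real.Gamma_pos_of_pos (by positivity)
  set c : ℝ := 15 * k * ρ ^ 6 / ((k + 4) * (k + 6) * (k + 8)) with hc
  have hcle : c ≤ 15 * (k : ℝ) ^ 4 / (1728 * ((k + 4) * (k + 6) * (k + 8))) := by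
    have h6 : (1728 : ℝ) * ρ ^ 6 ≤ (k : ℝ) ^ 3 := by
      calc 1728 * ρ ^ 6 = (12 * ρ ^ 2) ^ 3 := by ring
        _ ≤ (k : ℝ) ^ 3 := pow_le_pow_left₀ (by positivity) hshort 3
    rw [hc, ← div_div (15 * (k : ℝ) ^ 4)]
    refine div_le_div_of_nonneg_right (c := ((k : ℝ) + 4) * (k + 6) * (k + 8)) ?_ (by positivity)
    rw [le_div_iff₀ (by norm_num : (0 : ℝ) < 1728)]
    calc 15 * (k : ℝ) * ρ ^ 6 * 1728 = 15 * k * (1728 * ρ ^ 6) := by ring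
      _ ≤ 15 * k * (k : ℝ) ^ 3 := by gcongr
      _ = _ := by ring
  have hK' : Γ2 * 4 ^ k * Real.exp c ≤ K * (Real.sqrt Real.pi * Real.sqrt k) ^ k := by
    refine le_trans ?_ hK
    gcongr
  refine le_trans ?_ (mul_le_mul_of_nonneg_left (clipped_ball_integral_ge hm hρ)
    (by positivity : 0 ≤ K * Real.sqrt k ^ k))
  rw [← hΓ2, ← hc]
  calc (2 * ρ) ^ k = (Γ2 * 4 ^ k * Real.exp c) *
        ((1 / 2) ^ k * Real.exp (-c) * ρ ^ k / Γ2) := by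
        have h1 : Real.exp c * Real.exp (-c) = 1 := by
          rw [← Real.exp_add, add_neg_cancel, Real.exp_zero]
        have h2 : (4 : ℝ) ^ k * (1 / 2) ^ k = 2 ^ k := by rw [← mul_pow]; norm_num
        calc (2 * ρ) ^ k = (Γ2 / Γ2) * (4 ^ k * (1 / 2) ^ k) *
              (Real.exp c * Real.exp (-c)) * ρ ^ k := by
              rw [h1, h2, div_self hΓ2pos.ne', mul_pow]; ring
          _ = _ := by ring
    _ ≤ (K * (Real.sqrt Real.pi * Real.sqrt k) ^ k) *
        ((1 / 2) ^ k * Real.exp (-c) * ρ ^ k / Γ2) :=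
        mul_le_mul_of_nonneg_right hK' (by positivity)
    _ = _ := by rw [mul_pow]; ring

open MeasureTheory in
lemma two_mul_pow_le_of_long {k : ℕ} {m u : Fin k → ℝ}
    (hadd : ∀ i, m i + u i ∈ Set.Icc (0 : ℝ) 1) (hsub : ∀ i, m i - u i ∈ Set.Icc (0 : ℝ) 1)
    {ρ K : ℝ} (hρ : 0 < ρ) (hρu : ρ ^ 2 = ∑ i, u i ^ 2) (hlong : (k : ℝ) ≤ 12 * ρ ^ 2)
    (hK : Real.sqrt (k + 2) ^ k * (k + 2) ≤ 2 * K * Real.sqrt k ^ k) :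
    (2 * ρ) ^ k ≤ K * Real.sqrt k ^ k *
      ∫ x in Set.Icc (0 : Fin k → ℝ) 1, max 0 (1 - (∑ i, (x i - m i) ^ 2) / ρ ^ 2) := by
  have hm : ∀ i, m i ∈ Set.Icc (0 : ℝ) 1 := fun i =>
    ⟨by linarith [(hadd i).1, (hsub i).1], by linarith [(hadd i).2, (hsub i).2]⟩
  have hui : ∀ i, u i ^ 2 ≤ m i - m i ^ 2 := fun i => by
    have a := mul_nonneg (hadd i).1 (sub_nonneg.2 (hadd i).2)
    have b := mul_nonneg (hsub i).1 (sub_nonneg.2 (hsub i).2)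
    nlinarith
  have hsum : ∑ i, (1 / 3 - m i + m i ^ 2) ≤ (k : ℝ) / 4 := by
    have : ∑ i, (1 / 3 - m i + m i ^ 2) ≤ ∑ i : Fin k, (1 / 3 - u i ^ 2) :=
      Finset.sum_le_sum fun i _ => by linarith [hui i]
    rw [Finset.sum_sub_distrib, ← hρu, Finset.sum_const, Finset.card_univ, Fintype.card_fin,
      nsmul_eq_mul] at this
    linarith
  have hρk : 4 * ρ ^ 2 ≤ k := by
    have : ∑ i, u i ^ 2 ≤ ∑ i : Fin k, (1 / 4 : ℝ) :=
      Finset.sum_le_sum fun i _ => by nlinarith [hui i, sq_nonneg (m i - 1 / 2)]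
    rw [← hρu, Finset.sum_const, Finset.card_univ, Fintype.card_fin, nsmul_eq_mul] at this
    linarith
  have hk2 : (0 : ℝ) < k + 2 := by positivity
  have hs : 0 < Real.sqrt ((k : ℝ) + 2) := Real.sqrt_pos.2 hk2
  set θ := 2 * ρ / Real.sqrt ((k : ℝ) + 2) with hθ
  have hθ2 : θ ^ 2 = 4 * ρ ^ 2 / (k + 2) := by
    rw [hθ, div_pow, Real.sq_sqrt hk2.le]; ring
  have hθ0 : 0 < θ := by positivity
  have hθ1 : θ ≤ 1 := by
    refine (sq_le_one_iff₀ hθ0.le).1 ?_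
    rw [hθ2, div_le_one hk2]; linarith
  have hW := shrunken_cube_integral_le hm (R := ρ ^ 2) hθ0 hθ1
  have hcoef : 2 / ((k : ℝ) + 2) ≤ 1 - θ ^ 2 / ρ ^ 2 * ∑ i, (1 / 3 - m i + m i ^ 2) := by
    have e : θ ^ 2 / ρ ^ 2 = 4 / (k + 2) := by
      rw [hθ2]; field_simp
    rw [e]
    have := mul_le_mul_of_nonneg_left hsum (by positivity : (0 : ℝ) ≤ 4 / (k + 2))
    have e2 : 1 - 4 / ((k : ℝ) + 2) * (k / 4) = 2 / (k + 2) := by field_simp; ring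
    linarith
  have hW2 := (mul_le_mul_of_nonneg_left hcoef (by positivity : 0 ≤ θ ^ k)).trans hW
  set W := ∫ x in Set.Icc (0 : Fin k → ℝ) 1, max 0 (1 - (∑ i, (x i - m i) ^ 2) / ρ ^ 2)
  have hW0 : 0 ≤ W := le_trans (by positivity) hW2
  calc (2 * ρ) ^ k = Real.sqrt (k + 2) ^ k * (k + 2) / 2 * (θ ^ k * (2 / (k + 2))) := by
        have : 2 * ρ = Real.sqrt (k + 2) * θ := by rw [hθ]; field_simp
        rw [this, mul_pow]; field_simp
    _ ≤ Real.sqrt (k + 2) ^ k * (k + 2) / 2 * W :=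
        mul_le_mul_of_nonneg_left hW2 (by positivity)
    _ ≤ K * Real.sqrt k ^ k * W := mul_le_mul_of_nonneg_right (by linarith) hW0

lemma norm_add_sq_le_of_two_opt {E : Type*} [NormedAddCommGroup E] [InnerProductSpace ℝ E]
    {a b c d : E} (h : ‖a - b‖ ^ 2 + ‖c - d‖ ^ 2 ≤ ‖a - c‖ ^ 2 + ‖b - d‖ ^ 2) :
    ‖(1 / 2 : ℝ) • (b - a) + (1 / 2 : ℝ) • (d - c)‖ ^ 2 ≤
      ‖(1 / 2 : ℝ) • (a + b) - (1 / 2 : ℝ) • (c + d)‖ ^ 2 := by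
  simp only [← real_inner_self_eq_norm_sq, inner_add_left, inner_add_right, inner_sub_left,
    inner_sub_right, real_inner_smul_left, real_inner_smul_right] at h ⊢
  rw [real_inner_comm a b, real_inner_comm a c, real_inner_comm a d, real_inner_comm b c,
    real_inner_comm b d, real_inner_comm c d] at *
  linarith

open MeasureTheory in
lemma exists_cycle_sum_le {k : ℕ} (hk : 0 < k) {K : ℝ} (hK0 : 0 ≤ K)
    (hshort : Real.Gamma ((k : ℝ) / 2 + 2) * 4 ^ k *
        Real.exp (15 * (k : ℝ) ^ 4 / (1728 * ((k + 4) * (k + 6) * (k + 8)))) ≤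
      K * (Real.sqrt Real.pi * Real.sqrt k) ^ k)
    (hlong : Real.sqrt (k + 2) ^ k * (k + 2) ≤ 2 * K * Real.sqrt k ^ k)
    (X : Finset (EuclideanSpace ℝ (Fin k))) (hX : ∀ p ∈ X, ∀ i, p i ∈ Set.Icc (0 : ℝ) 1) :
    ∃ f : Fin X.card → EuclideanSpace ℝ (Fin k), IsHamCycle X f ∧
      ∑ i, ‖f i - f (nxt i)‖ ^ k ≤ 2 * K * Real.sqrt k ^ k := by
  classical
  obtain ⟨f, hinj, hmem, hopt⟩ := exists_two_opt X
  refine ⟨f, ⟨hinj, hmem⟩, ?_⟩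
  have hf : ∀ i j, f i j ∈ Set.Icc (0 : ℝ) 1 := fun i => hX _ ((hmem _).2 ⟨i, rfl⟩)
  set m : Fin X.card → EuclideanSpace ℝ (Fin k) := fun i => (1 / 2 : ℝ) • (f i + f (nxt i))
    with hm
  set u : Fin X.card → EuclideanSpace ℝ (Fin k) := fun i => (1 / 2 : ℝ) • (f (nxt i) - f i)
    with hu
  have hnorm : ∀ i, ‖f i - f (nxt i)‖ = 2 * ‖u i‖ := fun i => by
    rw [hu, norm_smul, norm_sub_rev]; norm_num; ring
  set s : Finset (Fin X.card) := Finset.univ.filter fun i => u i ≠ 0 with hs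
  have hus : ∀ i ∈ s, u i ≠ 0 := fun i hi => (Finset.mem_filter.1 hi).2
  set W : Fin X.card → ℝ := fun i => ∫ x in Set.Icc (0 : Fin k → ℝ) 1,
    max 0 (1 - (∑ j, (x j - m i j) ^ 2) / ‖u i‖ ^ 2) with hW
  have hedge : ∀ i ∈ s, ‖f i - f (nxt i)‖ ^ k ≤ K * Real.sqrt k ^ k * W i := by
    intro i hi
    have hρ : 0 < ‖u i‖ := norm_pos_iff.2 (hus i hi)
    have hadd : ∀ j, m i j + u i j ∈ Set.Icc (0 : ℝ) 1 := fun j => by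
      convert! hf (nxt i) j using 1
      simp only [hm, hu, PiLp.smul_apply, PiLp.add_apply, PiLp.sub_apply, smul_eq_mul]
      ring
    have hsub : ∀ j, m i j - u i j ∈ Set.Icc (0 : ℝ) 1 := fun j => by
      convert! hf i j using 1
      simp only [hm, hu, PiLp.smul_apply, PiLp.add_apply, PiLp.sub_apply, smul_eq_mul]
      ring
    rw [hnorm]
    rcases le_total (12 * ‖u i‖ ^ 2) (k : ℝ) with h | h
    · exact two_mul_pow_le_of_short (fun j =>
        ⟨by linarith [(hadd j).1, (hsub j).1], by linarith [(hadd j).2, (hsub j).2]⟩)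
        hρ h hshort hK0
    · exact two_mul_pow_le_of_long hadd hsub hρ (EuclideanSpace.real_norm_sq_eq _) h hlong
  have hinteg : ∀ i ∈ s, IntegrableOn (fun x : Fin k → ℝ =>
      max 0 (1 - (∑ j, (x j - m i j) ^ 2) / ‖u i‖ ^ 2)) (Set.Icc 0 1) := fun i _ =>
    (Continuous.continuousOn (by fun_prop)).integrableOn_compact isCompact_Icc
  have hWsum : ∑ i ∈ s, W i ≤ 2 := by
    rw [hW, ← integral_finsetSum _ hinteg]
    calc _ ≤ ∫ _ in Set.Icc (0 : Fin k → ℝ) 1, (2 : ℝ) := by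
          refine integral_mono (integrable_finsetSum _ hinteg)
            ((Continuous.continuousOn (by fun_prop)).integrableOn_compact isCompact_Icc)
            fun x => ?_
          have := sum_max_one_sub_le_two s m u hus
            (fun i _ j _ hij => norm_add_sq_le_of_two_opt (hopt i j hij)) (WithLp.toLp 2 x)
          simpa only [EuclideanSpace.real_norm_sq_eq (_ - _), PiLp.sub_apply] using this
      _ = 2 := by
          rw [setIntegral_const, volume_real_Icc_zero_one, one_smul]
  calc ∑ i, ‖f i - f (nxt i)‖ ^ k = ∑ i ∈ s, ‖f i - f (nxt i)‖ ^ k := by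
        rw [hs, Finset.sum_filter]
        refine Finset.sum_congr rfl fun i _ => ?_
        split_ifs with h
        · rfl
        · rw [hnorm, not_not.1 h, norm_zero, mul_zero, zero_pow hk.ne']
    _ ≤ ∑ i ∈ s, K * Real.sqrt k ^ k * W i := Finset.sum_le_sum hedge
    _ = K * Real.sqrt k ^ k * ∑ i ∈ s, W i := by rw [Finset.mul_sum]
    _ ≤ K * Real.sqrt k ^ k * 2 := mul_le_mul_of_nonneg_left hWsum (by positivity)
    _ = _ := by ring

lemma sqrt_add_two_pow_le (k : ℕ) :
    Real.sqrt ((k : ℝ) + 2) ^ k ≤ Real.exp 1 * Real.sqrt k ^ k := by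
  rcases Nat.eq_zero_or_pos k with rfl | hk
  · simp
  have hk0 : (0 : ℝ) < k := by exact_mod_cast hk
  have h1 : Real.sqrt ((k : ℝ) + 2) ≤ Real.exp (1 / k) * Real.sqrt k := by
    refine Real.sqrt_le_iff.2 ⟨by positivity, ?_⟩
    rw [mul_pow, Real.sq_sqrt hk0.le, ← Real.exp_nat_mul]
    have := Real.add_one_le_exp (((2 : ℕ) : ℝ) * (1 / k))
    calc (k : ℝ) + 2 = (((2 : ℕ) : ℝ) * (1 / k) + 1) * k := by
          push_cast; field_simp; ring
      _ ≤ _ := mul_le_mul_of_nonneg_right this hk0.le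
  calc Real.sqrt ((k : ℝ) + 2) ^ k ≤ (Real.exp (1 / k) * Real.sqrt k) ^ k :=
        pow_le_pow_left₀ (Real.sqrt_nonneg _) h1 k
    _ = _ := by
        rw [mul_pow, ← Real.exp_nat_mul, mul_one_div, div_self hk0.ne']

lemma exp_one_mul_le (k : ℕ) {t : ℕ} (ht : 1 ≤ t) :
    Real.exp 1 * k ≤ (2 * t + 1) * (1 + 1 / (t : ℝ)) ^ ((k : ℝ) / 2) := by
  have ht0 : (0 : ℝ) < t := by exact_mod_cast ht
  have h1 := Real.le_log_one_add_of_nonneg (x := 1 / (t : ℝ)) (by positivity)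
  have h2 : (2 : ℝ) / (2 * t + 1) ≤ Real.log (1 + 1 / t) := by
    refine le_trans (le_of_eq ?_) h1
    field_simp
    ring
  rw [Real.rpow_def_of_pos (by positivity)]
  have h3 : Real.exp ((k : ℝ) / (2 * t + 1)) ≤
      Real.exp (Real.log (1 + 1 / t) * (k / 2)) := by
    refine Real.exp_le_exp.2 ?_
    calc (k : ℝ) / (2 * t + 1) = 2 / (2 * t + 1) * (k / 2) := by ring
      _ ≤ _ := mul_le_mul_of_nonneg_right h2 (by positivity)
  have h4 : Real.exp 1 * ((k : ℝ) / (2 * t + 1)) ≤ Real.exp ((k : ℝ) / (2 * t + 1)) := by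
    have := Real.add_one_le_exp ((k : ℝ) / (2 * t + 1) - 1)
    calc Real.exp 1 * ((k : ℝ) / (2 * t + 1))
        ≤ Real.exp 1 * Real.exp ((k : ℝ) / (2 * t + 1) - 1) :=
          mul_le_mul_of_nonneg_left (by linarith) (Real.exp_pos _).le
      _ = _ := by rw [← Real.exp_add]; congr 1; ring
  calc Real.exp 1 * k = (2 * t + 1) * (Real.exp 1 * ((k : ℝ) / (2 * t + 1))) := by field_simp
    _ ≤ _ := mul_le_mul_of_nonneg_left (h4.trans h3) (by positivity)

lemma four_le_mul_rpow_half {t : ℕ} (ht : 1 ≤ t) :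
    4 ≤ (2 * t + 1) * (1 + 1 / (t : ℝ)) ^ ((1 : ℝ) / 2) := by
  rw [← Real.sqrt_eq_rpow]
  rcases ht.eq_or_lt with rfl | h
  · have : (4 / 3 : ℝ) ≤ Real.sqrt 2 := Real.le_sqrt_of_sq_le (by norm_num)
    norm_num
    linarith
  · have h2 : (2 : ℝ) ≤ t := by exact_mod_cast h
    have h1 : (1 : ℝ) ≤ Real.sqrt (1 + 1 / t) := Real.le_sqrt_of_sq_le (by
      have : (0 : ℝ) ≤ 1 / t := by positivity
      linarith)
    nlinarith

theorem hamCycle_upper_bound_t (k t : ℕ) (ht : 1 ≤ t)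
    (X : Finset (EuclideanSpace ℝ (Fin k)))
    (hX : ∀ p ∈ X, ∀ i, p i ∈ Set.Icc (0 : ℝ) 1) :
    ∃ f : Fin X.card → EuclideanSpace ℝ (Fin k), IsHamCycle X f ∧
      ∑ i, ‖f i - f (nxt i)‖ ^ k ≤
        2 * (2 * t + 1) * (1 + 1 / (t : ℝ)) ^ ((k : ℝ) / 2) * (k : ℝ) ^ ((k : ℝ) / 2) := by
  have hsqrt : (k : ℝ) ^ ((k : ℝ) / 2) = Real.sqrt k ^ k := by
    rw [Real.sqrt_eq_rpow, ← Real.rpow_mul_natCast (Nat.cast_nonneg k)]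
    congr 1; ring
  rw [hsqrt]
  rcases Nat.eq_zero_or_pos k with rfl | hk
  · obtain ⟨f, hinj, hmem, -⟩ := exists_two_opt X
    refine ⟨f, ⟨hinj, hmem⟩, ?_⟩
    have hcard : (X.card : ℝ) ≤ 1 := by
      exact_mod_cast Finset.card_le_one_of_subsingleton X
    have : (0 : ℝ) ≤ t := Nat.cast_nonneg t
    simp
    linarith
  suffices h : ∃ K : ℝ, 0 ≤ K ∧
      Real.Gamma ((k : ℝ) / 2 + 2) * 4 ^ k *
        Real.exp (15 * (k : ℝ) ^ 4 / (1728 * ((k + 4) * (k + 6) * (k + 8)))) ≤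
        K * (Real.sqrt Real.pi * Real.sqrt k) ^ k ∧
      Real.sqrt (k + 2) ^ k * (k + 2) ≤ 2 * K * Real.sqrt k ^ k ∧
      K ≤ (2 * t + 1) * (1 + 1 / (t : ℝ)) ^ ((k : ℝ) / 2) by
    obtain ⟨K, hK0, hshort, hlong, hKt⟩ := h
    obtain ⟨f, hf, hsum⟩ := exists_cycle_sum_le hk hK0 hshort hlong X hX
    refine ⟨f, hf, hsum.trans ?_⟩
    have := mul_le_mul_of_nonneg_right hKt (by positivity : 0 ≤ 2 * Real.sqrt k ^ k)
    linarith
  rcases (Nat.succ_le_of_lt hk).eq_or_lt with rfl | hk2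
  · refine ⟨4, by norm_num, ?_, ?_, ?_⟩
    · refine Gamma_mul_exp_le_of_odd (n := 0) ?_ (by norm_num) ?_ <;>
        norm_num [Nat.doubleFactorial]
    · have : Real.sqrt 3 ≤ 2 := Real.sqrt_le_iff.2 ⟨by norm_num, by norm_num⟩
      norm_num
      linarith
    · simpa using four_le_mul_rpow_half ht
  · refine ⟨Real.exp 1 * k, by positivity, Gamma_mul_exp_le hk2, ?_, exp_one_mul_le k ht⟩
    have h2 : (2 : ℝ) ≤ k := by exact_mod_cast hk2
    calc Real.sqrt (k + 2) ^ k * (k + 2) ≤ (Real.exp 1 * Real.sqrt k ^ k) * (2 * k) :=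
          mul_le_mul (sqrt_add_two_pow_le k) (by linarith) (by positivity) (by positivity)
      _ = _ := by ring
end

section
/- For every finite set X in the unit cube [0,1]^k, there exists a Hamiltonian cycle H on X with sum over edges e of H of |e|^k at most 2e(k+1) * k^{k/2}, where e = 2.718... is Euler's number. -/
open MeasureTheory

theorem inner_sub_sub_sub_sub {E : Type*} [NormedAddCommGroup E] [InnerProductSpace ℝ E]
    (a b c d : E) : inner ℝ (a - d) (b - c) =
      inner ℝ a b + inner ℝ c d - inner ℝ a c - inner ℝ b d := by
  rw [inner_sub_left, inner_sub_right, inner_sub_right, real_inner_comm b d, real_inner_comm c d]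
  ring

/-- If `2`-opt exchanges do not shorten a family of segments `[a i, b i]`, then no point is close
to the midpoints of all of them. -/
theorem exists_segment_midpoint_far {E ι : Type*} [NormedAddCommGroup E] [InnerProductSpace ℝ E]
    (S : Finset ι) (hS : S.Nonempty) (a b : ι → E) (z : E)
    (hab : ∀ i ∈ S, ∀ j ∈ S, i ≠ j → 0 ≤ inner ℝ (a i - b j) (b i - a j)) :
    ∃ i ∈ S, ((S.card : ℝ) - 2) * (‖a i - b i‖ / 2) ^ 2 ≤
      S.card * ‖z - midpoint ℝ (a i) (b i)‖ ^ 2 := by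
  classical
  by_contra! hlt
  set β : ι → ℝ := fun i => inner ℝ (a i - z) (b i - z) with hβ
  have hpair : ∀ i ∈ S, ∀ j ∈ S,
      inner ℝ (a i - z) (a j - z) + inner ℝ (b i - z) (b j - z) ≤
        β i + β j + if i = j then ‖a i - b i‖ ^ 2 else 0 := by
    intro i hi j hj
    split_ifs with h
    · subst h
      have : a i - b i = (a i - z) - (b i - z) := by abel
      simp only [hβ]
      rw [this]
      generalize a i - z = p
      generalize b i - z = q
      rw [norm_sub_sq_real, real_inner_self_eq_norm_sq, real_inner_self_eq_norm_sq]
      linarith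
    · have h1 := hab i hi j hj h
      have e1 : a i - b j = (a i - z) - (b j - z) := by abel
      have e2 : b i - a j = (b i - z) - (a j - z) := by abel
      rw [e1, e2, inner_sub_sub_sub_sub] at h1
      simp only [hβ]
      linarith
  have hsum := Finset.sum_le_sum fun i hi => Finset.sum_le_sum (hpair i hi)
  have hpos : 0 ≤ ∑ i ∈ S, ∑ j ∈ S,
      (inner ℝ (a i - z) (a j - z) + inner ℝ (b i - z) (b j - z)) := by
    simp only [Finset.sum_add_distrib, ← inner_sum, ← sum_inner]
    exact add_nonneg real_inner_self_nonneg real_inner_self_nonneg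
  have hmid : ∀ i, β i = ‖z - midpoint ℝ (a i) (b i)‖ ^ 2 - (‖a i - b i‖ / 2) ^ 2 := by
    intro i
    have e1 : a i - b i = (a i - z) - (b i - z) := by abel
    have e2 : z - midpoint ℝ (a i) (b i) = -((1 / 2 : ℝ) • ((a i - z) + (b i - z))) := by
      rw [midpoint_eq_smul_add, invOf_eq_inv]
      module
    simp only [hβ]
    rw [e2, norm_neg, norm_smul, e1]
    generalize a i - z = p
    generalize b i - z = q
    rw [mul_pow, div_pow, norm_add_sq_real, norm_sub_sq_real]
    norm_num
    ring
  have hneg : ∑ i ∈ S, ∑ j ∈ S, (β i + β j + if i = j then ‖a i - b i‖ ^ 2 else 0) < 0 := by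
    have : ∑ i ∈ S, ∑ j ∈ S, (β i + β j + if i = j then ‖a i - b i‖ ^ 2 else 0) =
        ∑ i ∈ S, (2 * S.card * β i + ‖a i - b i‖ ^ 2) := by
      have h : ∀ i ∈ S, ∑ j ∈ S, (β i + β j + if i = j then ‖a i - b i‖ ^ 2 else 0) =
          (S.card * β i + ‖a i - b i‖ ^ 2) + ∑ j ∈ S, β j := by
        intro i hi
        simp [Finset.sum_add_distrib, hi]
        ring
      rw [Finset.sum_congr rfl h]
      simp only [Finset.sum_add_distrib, Finset.sum_const, ← Finset.mul_sum, nsmul_eq_mul]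
      ring
    rw [this]
    refine Finset.sum_neg (fun i hi => ?_) hS
    have := hlt i hi
    rw [hmid]
    nlinarith
  linarith

/-- Reversal of the block `l, …, r` of `ℕ`. -/
def reverseBlock (l r x : ℕ) : ℕ := if l ≤ x ∧ x ≤ r then l + r - x else x

theorem reverseBlock_involutive (l r : ℕ) : Function.Involutive (reverseBlock l r) := by
  intro x
  unfold reverseBlock
  split_ifs <;> omega

theorem reverseBlock_lt {l r n x : ℕ} (hr : r < n) (hx : x < n) : reverseBlock l r x < n := by
  unfold reverseBlock
  split_ifs <;> omega

/-- Reversal of the block `l, …, r` of `Fin n`, as a permutation. -/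
def reversePerm {n : ℕ} (l r : ℕ) (hr : r < n) : Equiv.Perm (Fin n) :=
  Function.Involutive.toPerm (fun x => ⟨reverseBlock l r x, reverseBlock_lt hr x.isLt⟩)
    fun x => Fin.ext (reverseBlock_involutive l r x)

/-- The effect of a `2`-opt exchange on the total edge cost of a cyclic ordering. -/
theorem sum_reversePerm {n : ℕ} {α : Type*} (f : Fin n → α) (d : α → α → ℝ)
    (hd : ∀ x y, d x y = d y x) {i j : Fin n} (hij : i < j) :
    ∑ l, d (f (reversePerm (i + 1) j j.isLt l)) (f (reversePerm (i + 1) j j.isLt (nxt l))) +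
        (d (f i) (f (nxt i)) + d (f j) (f (nxt j))) =
      ∑ l, d (f l) (f (nxt l)) + (d (f i) (f j) + d (f (nxt i)) (f (nxt j))) := by
  have hi := i.isLt
  have hj := j.isLt
  have hij' : i.val < j.val := hij
  have hjn : j.val - 1 < n := by omega
  set ρ : Equiv.Perm (Fin n) := reversePerm (i + 1) j j.isLt with hρ
  set τ : Equiv.Perm (Fin n) := reversePerm (i + 1) (j - 1) hjn with hτ
  have nxt_val : ∀ l : Fin n, (nxt l).val = if l.val + 1 = n then 0 else l.val + 1 := by
    intro l
    have := l.isLt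
    simp only [nxt]
    split_ifs with h
    · rw [h, Nat.mod_self]
    · exact Nat.mod_eq_of_lt (by omega)
  have ρ_val : ∀ l : Fin n, (ρ l).val = reverseBlock (i + 1) j l := fun _ => rfl
  have τ_val : ∀ l : Fin n, (τ l).val = reverseBlock (i + 1) (j - 1) l := fun _ => rfl
  have hρi : ρ i = i := by
    apply Fin.ext; rw [ρ_val]; unfold reverseBlock; split_ifs <;> omega
  have hρni : ρ (nxt i) = j := by
    apply Fin.ext; rw [ρ_val, nxt_val]; unfold reverseBlock; split_ifs <;> omega
  have hρj : ρ j = nxt i := by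
    apply Fin.ext; rw [ρ_val, nxt_val]; unfold reverseBlock; split_ifs <;> omega
  have hρnj : ρ (nxt j) = nxt j := by
    apply Fin.ext; rw [ρ_val, nxt_val]; unfold reverseBlock; split_ifs <;> omega
  have hτi : τ i = i := by
    apply Fin.ext; rw [τ_val]; unfold reverseBlock; split_ifs <;> omega
  have hτj : τ j = j := by
    apply Fin.ext; rw [τ_val]; unfold reverseBlock; split_ifs <;> omega
  have hother : ∀ l, l ≠ i ∧ l ≠ j →
      d (f (ρ l)) (f (ρ (nxt l))) - d (f (τ l)) (f (nxt (τ l))) = 0 := by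
    rintro l ⟨hli, hlj⟩
    have hli' : l.val ≠ i.val := fun h => hli (Fin.ext h)
    have hlj' : l.val ≠ j.val := fun h => hlj (Fin.ext h)
    have hl := l.isLt
    by_cases hb : i.val < l.val ∧ l.val < j.val
    · have h1 : ρ l = nxt (τ l) := by
        apply Fin.ext; rw [nxt_val, ρ_val, τ_val]; unfold reverseBlock; split_ifs <;> omega
      have h2 : ρ (nxt l) = τ l := by
        apply Fin.ext; rw [ρ_val, nxt_val, τ_val]; unfold reverseBlock; split_ifs <;> omega
      rw [h1, h2, hd, sub_self]
    · have h0 : τ l = l := by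
        apply Fin.ext; rw [τ_val]; unfold reverseBlock; split_ifs <;> omega
      have h1 : ρ l = l := by
        apply Fin.ext; rw [ρ_val]; unfold reverseBlock; split_ifs <;> omega
      have h2 : ρ (nxt l) = nxt l := by
        apply Fin.ext; rw [ρ_val, nxt_val]; unfold reverseBlock; split_ifs <;> omega
      rw [h0, h1, h2, sub_self]
  have hdiff := Fintype.sum_eq_add i j hij.ne hother
  rw [Finset.sum_sub_distrib, Equiv.sum_comp τ fun l => d (f l) (f (nxt l)), hρi, hρni, hρj, hρnj,
    hτi, hτj] at hdiff
  linarith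

/-- Every finite family of points has a cyclic ordering that no `2`-opt exchange improves, with
respect to the sum of squared edge lengths. -/
theorem exists_perm_two_opt {E : Type*} [NormedAddCommGroup E] [InnerProductSpace ℝ E] {n : ℕ}
    (f : Fin n → E) : ∃ σ : Equiv.Perm (Fin n), ∀ i j, i ≠ j →
      0 ≤ inner ℝ (f (σ i) - f (σ (nxt j))) (f (σ (nxt i)) - f (σ j)) := by
  obtain ⟨σ, hσ⟩ := Finite.exists_min fun σ : Equiv.Perm (Fin n) =>
    ∑ l, ‖f (σ l) - f (σ (nxt l))‖ ^ 2
  refine ⟨σ, ?_⟩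
  have key : ∀ i j, i < j →
      0 ≤ inner ℝ (f (σ i) - f (σ (nxt j))) (f (σ (nxt i)) - f (σ j)) := by
    intro i j hij
    have h1 := hσ ((reversePerm (i + 1) j j.isLt).trans σ)
    have h2 := sum_reversePerm (fun l => f (σ l)) (fun x y => ‖x - y‖ ^ 2)
      (fun x y => by rw [norm_sub_rev]) hij
    simp only [Equiv.trans_apply] at h1 h2
    have h3 : ‖f (σ i) - f (σ (nxt i))‖ ^ 2 + ‖f (σ j) - f (σ (nxt j))‖ ^ 2 ≤
        ‖f (σ i) - f (σ j)‖ ^ 2 + ‖f (σ (nxt i)) - f (σ (nxt j))‖ ^ 2 := by linarith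
    simp only [norm_sub_sq_real] at h3
    rw [inner_sub_sub_sub_sub]
    linarith
  intro i j hij
  rcases lt_or_gt_of_ne hij with h | h
  · exact key i j h
  · have := key j i h
    rw [real_inner_comm, ← inner_neg_neg]
    simpa using this

/-- At least half of a ball centred at the midpoint of a chord of a larger ball, and of radius at
most half the length of the chord, lies in the larger ball. -/
theorem measure_ball_le_two_mul_inter {E : Type*} [NormedAddCommGroup E] [InnerProductSpace ℝ E]
    [MeasurableSpace E] [BorelSpace E] [FiniteDimensional ℝ E]
    (μ : Measure E) [μ.IsAddHaarMeasure] {c m : E} {r R : ℝ} (hR : 0 ≤ R)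
    (h : r ^ 2 + ‖m - c‖ ^ 2 ≤ R ^ 2) :
    μ (Metric.ball m r) ≤ 2 * μ (Metric.ball m r ∩ Metric.closedBall c R) := by
  set A := Metric.ball m r ∩ Metric.closedBall c R with hA
  have hmp : MeasurePreserving (fun z => (2 : ℝ) • m - z) μ μ :=
    μ.measurePreserving_sub_left ((2 : ℝ) • m)
  have hAm : MeasurableSet A := measurableSet_ball.inter measurableSet_closedBall
  have half : ∀ z, ‖z - m‖ < r → inner ℝ (z - m) (m - c) ≤ 0 → z ∈ A := by
    intro z hz hin
    refine ⟨by rwa [mem_ball_iff_norm], ?_⟩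
    rw [mem_closedBall_iff_norm]
    have e : z - c = (z - m) + (m - c) := by abel
    have h1 : ‖z - c‖ ^ 2 ≤ R ^ 2 := by
      rw [e, norm_add_sq_real]
      have : ‖z - m‖ ^ 2 ≤ r ^ 2 := pow_le_pow_left₀ (norm_nonneg _) hz.le 2
      linarith
    exact (pow_le_pow_iff_left₀ (norm_nonneg _) hR two_ne_zero).1 h1
  have hsub : Metric.ball m r ⊆ A ∪ (fun z => (2 : ℝ) • m - z) ⁻¹' A := by
    intro z hz
    rw [mem_ball_iff_norm] at hz
    rcases le_total (inner ℝ (z - m) (m - c)) 0 with hin | hin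
    · exact Or.inl (half z hz hin)
    · refine Or.inr (half _ ?_ ?_)
      all_goals have e : (2 : ℝ) • m - z - m = -(z - m) := by module
      · rwa [e, norm_neg]
      · rw [e, inner_neg_left]
        linarith
  calc μ (Metric.ball m r) ≤ μ (A ∪ (fun z => (2 : ℝ) • m - z) ⁻¹' A) := measure_mono hsub
    _ ≤ μ A + μ ((fun z => (2 : ℝ) • m - z) ⁻¹' A) := measure_union_le _ _
    _ = 2 * μ A := by rw [hmp.measure_preimage hAm.nullMeasurableSet, two_mul]

/-- Sets covering every point at most `N` times have total measure at most `N` times that of the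
ambient set. -/
theorem sum_measure_inter_le_mul {α ι : Type*} [MeasurableSpace α] [Fintype ι] (μ : Measure α)
    (B : ι → Set α) (hB : ∀ i, MeasurableSet (B i)) (D : Set α) (N : ℕ)
    (hN : ∀ z, ∀ S : Finset ι, (∀ i ∈ S, z ∈ B i) → S.card ≤ N) :
    ∑ i, μ (B i ∩ D) ≤ N * μ D := by
  classical
  calc ∑ i, μ (B i ∩ D) = ∑ i, ∫⁻ z in D, (B i).indicator 1 z ∂μ := by
        refine Finset.sum_congr rfl fun i _ => ?_
        rw [lintegral_indicator_one (hB i), Measure.restrict_apply (hB i)]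
    _ = ∫⁻ z in D, ∑ i, (B i).indicator 1 z ∂μ :=
        (lintegral_finsetSum _ fun i _ => measurable_one.indicator (hB i)).symm
    _ ≤ ∫⁻ _ in D, (N : ENNReal) ∂μ := by
        refine lintegral_mono fun z => ?_
        simp only [Set.indicator_apply, Pi.one_apply, Finset.sum_boole]
        exact_mod_cast hN z _ fun i hi => (Finset.mem_filter.1 hi).2
    _ = N * μ D := by simp

/-- A finite family of segments in a ball which is stable under `2`-opt exchanges has bounded sum
of `k`-th powers of lengths. -/
theorem sum_norm_pow_le_of_two_opt {E ι : Type*} [NormedAddCommGroup E] [InnerProductSpace ℝ E]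
    [FiniteDimensional ℝ E] [Fintype ι] {k : ℕ} (hk : 0 < k) (hE : Module.finrank ℝ E = k)
    (a b : ι → E) (c : E) {R : ℝ} (hR : 0 ≤ R)
    (ha : ∀ i, ‖a i - c‖ ≤ R) (hb : ∀ i, ‖b i - c‖ ≤ R)
    (hab : ∀ i j, i ≠ j → 0 ≤ inner ℝ (a i - b j) (b i - a j)) :
    ∑ i, ‖a i - b i‖ ^ k ≤ 2 * Real.exp 1 * (k + 1) * (2 * R) ^ k := by
  borelize E
  have : Nontrivial E := Module.finrank_pos_iff.1 (hE ▸ hk)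
  have hk' : (0 : ℝ) < k := by exact_mod_cast hk
  let μ : Measure E := Measure.addHaar
  set t : ℝ := Real.exp (-(1 / k)) with ht
  have ht0 : 0 < t := Real.exp_pos _
  have ht1 : t ≤ 1 := Real.exp_le_one_iff.2 (by simp)
  have htk : t ^ k * Real.exp 1 = 1 := by
    rw [ht, ← Real.exp_nat_mul, ← Real.exp_add, Real.exp_eq_one_iff]
    field_simp
    ring
  have ht2 : (k + 2) * t ^ 2 ≤ k := by
    have h1 : 2 / (k : ℝ) + 1 ≤ Real.exp (2 / k) := Real.add_one_le_exp _
    have h2 : t ^ 2 * Real.exp (2 / k) = 1 := by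
      rw [ht, ← Real.exp_nat_mul, ← Real.exp_add, Real.exp_eq_one_iff]
      push_cast
      ring
    have h3 : (k : ℝ) + 2 = k * (2 / k + 1) := by field_simp; ring
    calc (k + 2) * t ^ 2 = k * (t ^ 2 * (2 / k + 1)) := by rw [h3]; ring
      _ ≤ k * (t ^ 2 * Real.exp (2 / k)) := by gcongr
      _ = k := by rw [h2, mul_one]
  set m : ι → E := fun i => midpoint ℝ (a i) (b i) with hm
  set r : ι → ℝ := fun i => t * (‖a i - b i‖ / 2) with hr
  have hr0 : ∀ i, 0 ≤ r i := fun i => by positivity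
  have hcover : ∀ z, ∀ S : Finset ι, (∀ i ∈ S, z ∈ Metric.ball (m i) (r i)) →
      S.card ≤ k + 1 := by
    intro z S hS
    by_contra! hcard
    obtain ⟨T, hTS, hT⟩ := Finset.exists_subset_card_eq (show k + 2 ≤ S.card by omega)
    obtain ⟨i, hi, hle⟩ := exists_segment_midpoint_far T (Finset.card_pos.1 (by omega)) a b z
      fun i _ j _ => hab i j
    have hz := hS i (hTS hi)
    rw [mem_ball_iff_norm] at hz
    have hz2 : ‖z - m i‖ ^ 2 < r i ^ 2 := pow_lt_pow_left₀ hz (norm_nonneg _) two_ne_zero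
    rw [hT] at hle
    push_cast at hle
    have h4 : (k + 2) * ‖z - m i‖ ^ 2 < (k + 2) * r i ^ 2 := by gcongr
    have h5 : (k + 2) * r i ^ 2 ≤ k * (‖a i - b i‖ / 2) ^ 2 := by
      rw [hr, mul_pow, ← mul_assoc]
      gcongr
    linarith
  have hhalf : ∀ i, μ (Metric.ball (m i) (r i)) ≤
      2 * μ (Metric.ball (m i) (r i) ∩ Metric.closedBall c R) := by
    intro i
    refine measure_ball_le_two_mul_inter μ hR ?_
    have h1 : r i ^ 2 ≤ (‖a i - b i‖ / 2) ^ 2 := by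
      refine pow_le_pow_left₀ (hr0 i) ?_ 2
      exact mul_le_of_le_one_left (by positivity) ht1
    have e1 : a i - b i = (a i - c) - (b i - c) := by abel
    have e2 : m i - c = (1 / 2 : ℝ) • ((a i - c) + (b i - c)) := by
      rw [hm]
      simp only [midpoint_eq_smul_add, invOf_eq_inv]
      module
    have h2 : (‖a i - b i‖ / 2) ^ 2 + ‖m i - c‖ ^ 2 =
        (‖a i - c‖ ^ 2 + ‖b i - c‖ ^ 2) / 2 := by
      rw [e1, e2, norm_smul]
      generalize a i - c = p
      generalize b i - c = q
      rw [mul_pow, div_pow, norm_add_sq_real, norm_sub_sq_real]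
      norm_num
      ring
    have h3 : ‖a i - c‖ ^ 2 ≤ R ^ 2 := pow_le_pow_left₀ (norm_nonneg _) (ha i) 2
    have h4 : ‖b i - c‖ ^ 2 ≤ R ^ 2 := pow_le_pow_left₀ (norm_nonneg _) (hb i) 2
    linarith
  have htotal : ∑ i, μ (Metric.ball (m i) (r i)) ≤
      2 * ((k + 1 : ℕ) * μ (Metric.closedBall c R)) := by
    calc ∑ i, μ (Metric.ball (m i) (r i))
        ≤ ∑ i, 2 * μ (Metric.ball (m i) (r i) ∩ Metric.closedBall c R) :=
          Finset.sum_le_sum fun i _ => hhalf i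
      _ ≤ _ := by
          rw [← Finset.mul_sum]
          gcongr
          exact sum_measure_inter_le_mul μ _ (fun i => measurableSet_ball) _ _ hcover
  have hv0 : μ (Metric.ball 0 1) ≠ 0 := (Metric.measure_ball_pos μ 0 one_pos).ne'
  have hvtop : μ (Metric.ball 0 1) ≠ ⊤ := measure_ball_lt_top.ne
  have hreal : ∑ i, r i ^ k ≤ 2 * ((k + 1) * R ^ k) := by
    simp only [μ.addHaar_ball _ (hr0 _), μ.addHaar_closedBall _ hR, hE, ← Finset.sum_mul,
      ← mul_assoc] at htotal
    rw [ENNReal.mul_le_mul_iff_left hv0 hvtop,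
      ← ENNReal.ofReal_sum_of_nonneg fun i _ => pow_nonneg (hr0 i) k] at htotal
    have e : (2 : ENNReal) * ((k + 1 : ℕ) : ENNReal) * ENNReal.ofReal (R ^ k) =
        ENNReal.ofReal (2 * ((k + 1) * R ^ k)) := by
      rw [ENNReal.ofReal_mul zero_le_two, ENNReal.ofReal_mul (by positivity), ← mul_assoc]
      congr 2
      · simp
      · rw [← ENNReal.ofReal_natCast]
        push_cast
        rfl
    rw [e] at htotal
    exact (ENNReal.ofReal_le_ofReal_iff (by positivity)).1 htotal
  calc ∑ i, ‖a i - b i‖ ^ k = 2 ^ k * Real.exp 1 * ∑ i, r i ^ k := by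
        rw [Finset.mul_sum]
        refine Finset.sum_congr rfl fun i _ => ?_
        rw [hr, mul_pow, div_pow]
        field_simp
        rw [mul_assoc, mul_comm (Real.exp 1), htk, mul_one]
    _ ≤ 2 ^ k * Real.exp 1 * (2 * ((k + 1) * R ^ k)) := by gcongr
    _ = 2 * Real.exp 1 * (k + 1) * (2 * R) ^ k := by ring

/-- Points of the unit cube lie in its circumscribed ball. -/
theorem norm_sub_cube_center_le {k : ℕ} (p : EuclideanSpace ℝ (Fin k))
    (hp : ∀ i, p i ∈ Set.Icc (0 : ℝ) 1) :
    ‖p - WithLp.toLp 2 fun _ => (1 / 2 : ℝ)‖ ≤ √k / 2 := by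
  rw [EuclideanSpace.norm_eq]
  have h : √(k : ℝ) / 2 = √((k : ℝ) * (1 / 4)) := by
    rw [Real.sqrt_mul (Nat.cast_nonneg k), show (1 / 4 : ℝ) = (1 / 2) ^ 2 by norm_num,
      Real.sqrt_sq (by norm_num)]
    ring
  rw [h]
  refine Real.sqrt_le_sqrt ?_
  calc _ ≤ ∑ _ : Fin k, (1 / 4 : ℝ) := by
        refine Finset.sum_le_sum fun i _ => ?_
        obtain ⟨h0, h1⟩ := hp i
        simp only [PiLp.sub_apply, Real.norm_eq_abs, sq_abs]
        nlinarith
    _ = k * (1 / 4) := by simp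

theorem hamCycle_upper_bound (k : ℕ) (X : Finset (EuclideanSpace ℝ (Fin k)))
    (hX : ∀ p ∈ X, ∀ i, p i ∈ Set.Icc (0 : ℝ) 1) :
    ∃ f : Fin X.card → EuclideanSpace ℝ (Fin k), IsHamCycle X f ∧
      ∑ i, ‖f i - f (nxt i)‖ ^ k ≤
        2 * Real.exp 1 * (k + 1) * (k : ℝ) ^ ((k : ℝ) / 2) := by
  let f₀ : Fin X.card → EuclideanSpace ℝ (Fin k) := fun i => (X.equivFin.symm i : _)
  obtain ⟨σ, hσ⟩ := exists_perm_two_opt f₀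
  have hmem : ∀ i, f₀ (σ i) ∈ X := fun i => (X.equivFin.symm (σ i)).2
  refine ⟨f₀ ∘ σ, ⟨(Subtype.val_injective.comp X.equivFin.symm.injective).comp σ.injective,
    fun x => ⟨fun hx => ⟨σ.symm (X.equivFin ⟨x, hx⟩), by simp [f₀]⟩, ?_⟩⟩, ?_⟩
  · rintro ⟨i, rfl⟩
    exact hmem i
  rcases Nat.eq_zero_or_pos k with rfl | hk
  · have hcard : (X.card : ℝ) ≤ 1 := by exact_mod_cast Finset.card_le_one_of_subsingleton X
    have he := Real.add_one_le_exp (1 : ℝ)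
    simp
    linarith
  · have hpow : (2 * (√(k : ℝ) / 2)) ^ k = (k : ℝ) ^ ((k : ℝ) / 2) := by
      rw [mul_div_cancel₀ _ two_ne_zero, Real.sqrt_eq_rpow, ← Real.rpow_mul_natCast
        (Nat.cast_nonneg k)]
      congr 1
      ring
    rw [← hpow]
    exact sum_norm_pow_le_of_two_opt hk (by simp) (fun i => f₀ (σ i)) (fun i => f₀ (σ (nxt i)))
      (WithLp.toLp 2 fun _ => (1 / 2 : ℝ)) (by positivity)
      (fun i => norm_sub_cube_center_le _ (hX _ (hmem _)))
      (fun i => norm_sub_cube_center_le _ (hX _ (hmem _))) hσ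
end
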